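/- arXiv:1606.06940 — 2 statements merged into one kernel-verified Lean document; each statement's English description precedes it below -/
import Mathlib

section
/- Any x-monotone rectilinear polygon can be transformed into a canonical x-monotone polygon realizing the same angle sequence without increasing the area of its bounding box, where canonical means: (D1) all outer extreme edges lie on the boundary of the bounding box, (D2) every vertical non-extreme edge not incident to an inner extreme edge has length 1, and (D3) every horizontal edge that is not an outer extreme edge has length 1. -/
/-- Cross product of two planar integer vectors. -/
def cross (d e : ℤ × ℤ) : ℤ := d.1 * e.2 - d.2 * e.1

/-- Membership in an axis-parallel lattice segment with endpoints `a`, `b`. -/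
def onSeg (a b p : ℤ × ℤ) : Prop :=
  min a.1 b.1 ≤ p.1 ∧ p.1 ≤ max a.1 b.1 ∧ min a.2 b.2 ≤ p.2 ∧ p.2 ≤ max a.2 b.2

/-- A simple rectilinear lattice polygon with `n` vertices: all edges are
axis-parallel, consecutive edges are perpendicular, and non-adjacent edges are
disjoint (adjacent edges meet only in their common endpoint). -/
structure RectPolygon (n : ℕ) where
  v : ZMod n → ℤ × ℤ
  nondeg : ∀ i, v (i + 1) ≠ v i
  axis : ∀ i, (v (i + 1)).1 = (v i).1 ∨ (v (i + 1)).2 = (v i).2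
  alt : ∀ i, ((v (i + 1)).1 = (v i).1 ↔ (v (i + 2)).2 = (v (i + 1)).2)
  simple : ∀ i j : ZMod n, j ≠ i → ∀ p : ℤ × ℤ,
    onSeg (v i) (v (i + 1)) p → onSeg (v j) (v (j + 1)) p →
    (j = i + 1 ∧ p = v j) ∨ (i = j + 1 ∧ p = v i)

namespace RectPolygon

variable {n : ℕ}

/-- Vector of edge `i` (from vertex `i` to vertex `i+1`). -/
def dvec (P : RectPolygon n) (i : ZMod n) : ℤ × ℤ := P.v (i + 1) - P.v i

/-- The turn at vertex `i` is a left (+90°, convex) turn. -/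
def convexAt (P : RectPolygon n) (i : ZMod n) : Prop := 0 < cross (P.dvec (i - 1)) (P.dvec i)

/-- The turn at vertex `i` is a right (−90°, reflex) turn. -/
def reflexAt (P : RectPolygon n) (i : ZMod n) : Prop := cross (P.dvec (i - 1)) (P.dvec i) < 0

def horiz (P : RectPolygon n) (i : ZMod n) : Prop := (P.v (i + 1)).2 = (P.v i).2

def vert (P : RectPolygon n) (i : ZMod n) : Prop := (P.v (i + 1)).1 = (P.v i).1

/-- Signed x-extent of edge `i`. -/
def sx (P : RectPolygon n) (i : ZMod n) : ℤ := (P.v (i + 1)).1 - (P.v i).1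

/-- Signed y-extent of edge `i`. -/
def sy (P : RectPolygon n) (i : ZMod n) : ℤ := (P.v (i + 1)).2 - (P.v i).2

/-- Length of edge `i`. -/
def elen (P : RectPolygon n) (i : ZMod n) : ℤ :=
  |(P.v (i + 1)).1 - (P.v i).1| + |(P.v (i + 1)).2 - (P.v i).2|

section
variable [NeZero n]

/-- Counterclockwise orientation (positive shoelace signed area). -/
def ccw (P : RectPolygon n) : Prop := 0 < ∑ i : ZMod n, cross (P.v i) (P.v (i + 1))

/-- The enclosed area of a ccw polygon (shoelace formula); for a rectilinear
lattice polygon this is the number of interior unit grid cells. -/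
def area (P : RectPolygon n) : ℤ := (∑ i : ZMod n, cross (P.v i) (P.v (i + 1))) / 2

/-- Perimeter: total length of all edges. -/
def perimeter (P : RectPolygon n) : ℤ := ∑ i : ZMod n, P.elen i

def maxX (P : RectPolygon n) : ℤ := Finset.univ.sup' Finset.univ_nonempty fun i : ZMod n => (P.v i).1
def minX (P : RectPolygon n) : ℤ := Finset.univ.inf' Finset.univ_nonempty fun i : ZMod n => (P.v i).1
def maxY (P : RectPolygon n) : ℤ := Finset.univ.sup' Finset.univ_nonempty fun i : ZMod n => (P.v i).2
def minY (P : RectPolygon n) : ℤ := Finset.univ.inf' Finset.univ_nonempty fun i : ZMod n => (P.v i).2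

/-- Width of the bounding box (a single unit edge gives width 1). -/
def width (P : RectPolygon n) : ℤ := P.maxX - P.minX

/-- Height of the bounding box. -/
def height (P : RectPolygon n) : ℤ := P.maxY - P.minY

/-- Area of the bounding box. -/
def bboxArea (P : RectPolygon n) : ℤ := P.width * P.height

end

/-- A simple rectilinear polygon is x-monotone iff the cyclic sequence of
x-directions of its horizontal edges has exactly two reversals. -/
def IsXMonotone (P : RectPolygon n) : Prop :=
  {i : ZMod n | P.horiz i ∧ P.sx i * P.sx (i + 2) < 0}.ncard = 2

def IsYMonotone (P : RectPolygon n) : Prop :=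
  {i : ZMod n | P.vert i ∧ P.sy i * P.sy (i + 2) < 0}.ncard = 2

def IsXYMonotone (P : RectPolygon n) : Prop := P.IsXMonotone ∧ P.IsYMonotone

/-- In a ccw x-monotone polygon, a reflex vertex lies on the upper chain iff its
adjacent horizontal edge points leftwards. -/
def upperReflex (P : RectPolygon n) (i : ZMod n) : Prop :=
  P.reflexAt i ∧ ((P.horiz (i - 1) ∧ P.sx (i - 1) < 0) ∨ (P.horiz i ∧ P.sx i < 0))

def lowerReflex (P : RectPolygon n) (i : ZMod n) : Prop :=
  P.reflexAt i ∧ ((P.horiz (i - 1) ∧ 0 < P.sx (i - 1)) ∨ (P.horiz i ∧ 0 < P.sx i))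

/-- Number of reflex vertices on the upper chain T. -/
noncomputable def rT (P : RectPolygon n) : ℕ := {i : ZMod n | P.upperReflex i}.ncard

/-- Number of reflex vertices on the lower chain B. -/
noncomputable def rB (P : RectPolygon n) : ℕ := {i : ZMod n | P.lowerReflex i}.ncard

end RectPolygon

/-- The block (LR)^k of an angle sequence (`true` = L, `false` = R). -/
def LRblock (k : ℕ) : List Bool := (List.replicate k [true, false]).flatten

/-- `P` realizes the angle sequence `S` via a counterclockwise boundary walk. -/
def realizes {m : ℕ} [NeZero m] (S : List Bool) (P : RectPolygon m) : Prop :=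
  m = S.length ∧ P.ccw ∧ ∀ i : Fin S.length,
    ((S.get i = true) ↔ P.convexAt ((i : ℕ) : ZMod m)) ∧
    ((S.get i = false) ↔ P.reflexAt ((i : ℕ) : ZMod m))

instance (k : ℕ) : NeZero (k + 4) := ⟨by omega⟩

/-- Edge `i` is an outer horizontal extreme edge (turn pattern LL). -/
def outerExtreme {n : ℕ} (P : RectPolygon n) (i : ZMod n) : Prop :=
  P.horiz i ∧ P.convexAt i ∧ P.convexAt (i + 1)

/-- Edge `i` is an inner horizontal extreme edge (turn pattern RR). -/
def innerExtreme {n : ℕ} (P : RectPolygon n) (i : ZMod n) : Prop :=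
  P.horiz i ∧ P.reflexAt i ∧ P.reflexAt (i + 1)

/-- A canonical x-monotone polygon: (D1) all outer extreme edges lie on the
boundary of the bounding box, (D2) every vertical non-extreme edge not incident
to an inner extreme edge has length 1, and (D3) every horizontal edge that is
not an outer extreme edge has length 1. -/
def canonicalBox {n : ℕ} [NeZero n] (P : RectPolygon n) : Prop :=
  (∀ i, outerExtreme P i → (P.v i).2 = P.maxY ∨ (P.v i).2 = P.minY) ∧
  (∀ i, P.vert i → (P.v i).1 ≠ P.minX → (P.v i).1 ≠ P.maxX →
    ¬ innerExtreme P (i - 1) → ¬ innerExtreme P (i + 1) → P.elen i = 1) ∧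
  (∀ i, P.horiz i → ¬ outerExtreme P i → P.elen i = 1)

/-- Position `j` of a rightward chain with heights `h` is a local minimum; the chain is
thought of as coming down into its first position. -/
def IsValley (h : ℕ → ℤ) (j : ℕ) : Prop := (j = 0 ∨ h j < h (j - 1)) ∧ h j < h (j + 1)

/-- Position `j` of a chain with heights `h` is an interior local maximum. -/
def IsPeak (h : ℕ → ℤ) (j : ℕ) : Prop := 0 < j ∧ h (j - 1) < h j ∧ h (j + 1) < h j

/-- Sequences defined by downward recursion from a given index. -/
lemma exists_backward_rec (a : ℕ) (x : ℤ) (F : ℕ → ℤ → ℤ) :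
    ∃ f : ℕ → ℤ, f a = x ∧ ∀ j < a, f j = F j (f (j + 1)) := by
  refine ⟨fun j => Nat.rec x (fun k y => F (a - 1 - k) y) (a - j), by simp, fun j hj => ?_⟩
  obtain ⟨k, rfl⟩ : ∃ k, a = j + k + 1 := ⟨a - j - 1, by omega⟩
  have h1 : j + k + 1 - j = k + 1 := by omega
  have h2 : j + k + 1 - (j + 1) = k := by omega
  have h3 : j + k + 1 - 1 - k = j := by omega
  simp only [h1, h2, h3]

lemma lt_of_forall_lt_succ {a : ℕ} {t : ℕ → ℤ} (ht : ∀ j < a, t j < t (j + 1)) {i j : ℕ}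
    (hij : i < j) (hj : j ≤ a) : t i < t j := by
  induction j with
  | zero => omega
  | succ k ih =>
    have := ht k (by omega)
    rcases Nat.lt_succ_iff_lt_or_eq.mp hij with h | h
    · exact (ih h (by omega)).trans this
    · rwa [h]

lemma le_of_forall_lt_succ {a : ℕ} {t : ℕ → ℤ} (ht : ∀ j < a, t j < t (j + 1)) {i j : ℕ}
    (hij : i ≤ j) (hj : j ≤ a) : t i ≤ t j := by
  rcases hij.eq_or_lt with h | h
  · rw [h]
  · exact (lt_of_forall_lt_succ ht h hj).le

/-- A chain can be replaced by one with the same ends and the same turns, lying weakly below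
it, whose valleys are at level `B` and whose other edges are as short as possible. -/
lemma exists_canonical_chain {a : ℕ} {t h : ℕ → ℤ} (ht : ∀ j < a, t j < t (j + 1))
    (hne : ∀ j, j + 1 < a → h j ≠ h (j + 1)) (hlast : h (a - 1) < h a)
    {B : ℤ} (hB : ∀ j < a, B ≤ h j) :
    ∃ t' h' : ℕ → ℤ, t' 0 = t 0 ∧ t' a = t a ∧ (∀ j < a, t' j < t' (j + 1)) ∧
      (∀ j, j + 1 < a → (h j < h (j + 1) ↔ h' j < h' (j + 1)) ∧ h' j ≠ h' (j + 1)) ∧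
      (∀ j < a, B ≤ h' j) ∧ (∀ j < a, IsValley h j → h' j = B) ∧
      (∀ j < a, ¬ IsValley h j → t' (j + 1) = t' j + 1) ∧
      (∀ j, j + 1 < a → ¬ IsPeak h j → ¬ IsPeak h (j + 1) → |h' (j + 1) - h' j| = 1) ∧
      (∀ j < a, ∀ i < a, ∀ c, t' j ≤ c → c < t' (j + 1) → t i ≤ c → c < t (i + 1) →
        h' j ≤ h i) := by
  obtain ⟨L, hL0, hL⟩ : ∃ L : ℕ → ℤ, L 0 = 0 ∧
      ∀ j, L (j + 1) = if h j < h (j + 1) then L j + 1 else 0 :=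
    ⟨fun j => Nat.rec 0 (fun j y => if h j < h (j + 1) then y + 1 else 0) j, rfl, fun _ => rfl⟩
  obtain ⟨R, hRa, hR⟩ := exists_backward_rec a 0
    (fun j y => if h (j + 1) < h j then y + 1 else 0)
  obtain ⟨α, hα0, hα⟩ : ∃ α : ℕ → ℤ, α 0 = t 0 ∧
      ∀ j, α (j + 1) = if h (j + 1) < h j then α j + 1 else t (j + 1) :=
    ⟨fun j => Nat.rec (t 0) (fun j y => if h (j + 1) < h j then y + 1 else t (j + 1)) j,
      rfl, fun _ => rfl⟩
  obtain ⟨β, hβa, hβ⟩ := exists_backward_rec a (t a)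
    (fun j y => if h j < h (j + 1) then y - 1 else t j)
  have hne' : ∀ j < a, h j ≠ h (j + 1) := by
    intro j hj
    by_cases hja : j + 1 < a
    · exact hne j hja
    · obtain rfl : a = j + 1 := by omega
      simpa using hlast.ne
  have hLnn : ∀ j, 0 ≤ L j := by
    intro j
    induction j with
    | zero => omega
    | succ j ih => rw [hL]; split_ifs <;> omega
  have hRnn : ∀ k j, j + k = a → 0 ≤ R j := by
    intro k
    induction k with
    | zero => intro j hj; obtain rfl : j = a := by omega
              omega
    | succ k ih =>
      intro j hj
      have := ih (j + 1) (by omega)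
      rw [hR j (by omega)]; split_ifs <;> omega
  have hLh : ∀ j < a, L j ≤ h j - B := by
    intro j
    induction j with
    | zero => intro hj; have := hB 0 hj; omega
    | succ j ih =>
      intro hj
      have := ih (by omega)
      have := hB (j + 1) hj
      rw [hL]; split_ifs <;> omega
  have hRh : ∀ k j, j + k + 1 = a → R j ≤ h j - B := by
    intro k
    induction k with
    | zero =>
      intro j hj
      have := hB j (by omega)
      rw [hR j (by omega), if_neg]
      · omega
      · obtain rfl : a = j + 1 := by omega
        simp only [Nat.add_sub_cancel] at hlast
        omega
    | succ k ih =>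
      intro j hj
      have := ih (j + 1) (by omega)
      have := hB j (by omega)
      rw [hR j (by omega)]; split_ifs <;> omega
  have hαt : ∀ j ≤ a, α j ≤ t j := by
    intro j
    induction j with
    | zero => intro; omega
    | succ j ih =>
      intro hj
      have := ih (by omega)
      have := ht j (by omega)
      rw [hα]; split_ifs <;> omega
  have hβt : ∀ k j, j + k = a → t j ≤ β j := by
    intro k
    induction k with
    | zero => intro j hj; obtain rfl : j = a := by omega
              omega
    | succ k ih =>
      intro j hj
      have := ih (j + 1) (by omega)
      have := ht j (by omega)
      rw [hβ j (by omega)]; split_ifs <;> omega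
  have up : ∀ k j i, j + k = i → i < a → t i < β j → h j ≤ h i := by
    intro k
    induction k with
    | zero => intro j i hji _ _; obtain rfl : j = i := by omega
              exact le_rfl
    | succ k ih =>
      intro j i hji hi hlt
      have h1 := lt_of_forall_lt_succ ht (show j < i by omega) (by omega)
      rw [hβ j (by omega)] at hlt
      split_ifs at hlt
      · have := ih (j + 1) i (by omega) hi (by omega)
        omega
      · omega
  have down : ∀ k j i, i + k = j → j < a → α j < t (i + 1) → h j ≤ h i := by
    intro k
    induction k with
    | zero => intro j i hji _ _; obtain rfl : i = j := by omega
              exact le_rfl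
    | succ k ih =>
      intro j i hji hj hlt
      obtain rfl : j = i + k + 1 := by omega
      have h1 := le_of_forall_lt_succ ht (show i + 1 ≤ i + k + 1 by omega) (by omega)
      rw [hα] at hlt
      split_ifs at hlt
      · have := ih (i + k) i (by omega) (by omega) (by omega)
        omega
      · omega
  have hlast' : ∀ j, j + 1 = a → h j < h (j + 1) := by
    rintro j rfl; simpa using hlast
  obtain ⟨T, hT⟩ : ∃ T : ℕ → ℤ, ∀ j, T j = if j = 0 ∨ h j < h (j - 1) then α j else β j :=
    ⟨_, fun _ => rfl⟩
  obtain ⟨H, hH⟩ : ∃ H : ℕ → ℤ, ∀ j, H j = B + max (L j) (R j) := ⟨_, fun _ => rfl⟩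
  have hTs : ∀ j, T (j + 1) = if h (j + 1) < h j then α (j + 1) else β (j + 1) := by
    intro j; rw [hT]; simp
  -- the situation at the left end of an edge
  have hleft : ∀ j < a, ((j = 0 ∨ h j < h (j - 1)) ∧ T j = α j ∧ L j = 0) ∨
      ((0 < j ∧ h (j - 1) < h j) ∧ T j = β j ∧ α j = t j) := by
    intro j hj
    rcases j with _ | j
    · left; simp [hT, hL0]
    · have := hne' j (by omega)
      rcases lt_or_gt_of_ne this with h1 | h1
      · right; rw [hTs, hα, if_neg (by omega), if_neg (by omega)]; simp [h1]
      · left; rw [hTs, hL, if_pos (by omega), if_neg (by omega)]; simp [h1]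
  have hright : ∀ j < a, (h j < h (j + 1) ∧ T (j + 1) = β (j + 1) ∧ R j = 0 ∧
        β j = β (j + 1) - 1 ∧ L (j + 1) = L j + 1) ∨
      (h (j + 1) < h j ∧ T (j + 1) = α (j + 1) ∧ R j = R (j + 1) + 1 ∧ β j = t j ∧
        α (j + 1) = α j + 1 ∧ L (j + 1) = 0) := by
    intro j hj
    have := hne' j (by omega)
    rcases lt_or_gt_of_ne this with h1 | h1
    · left
      rw [hTs, hR j hj, hβ j hj, hL, if_neg (by omega), if_neg (by omega), if_pos h1, if_pos h1]
      simp [h1]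
    · right
      rw [hTs, hR j hj, hβ j hj, hα, hL, if_pos (by omega), if_pos (by omega), if_pos h1,
        if_neg (by omega), if_neg (by omega)]
      simpa using h1
  refine ⟨T, H, ?_, ?_, ?_, ?_, ?_, ?_, ?_, ?_, ?_⟩
  · simp [hT, hα0]
  · rcases a with _ | a
    · simp [hT, hα0]
    · have := hlast' a rfl
      rw [hTs, if_neg (by omega), hβa]
  · intro j hj
    have h1 := hleft j hj
    have h2 := hright j hj
    have := ht j hj
    have := hαt j (by omega)
    have := hβt (a - (j + 1)) (j + 1) (by omega)
    omega
  · intro j hj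
    have h2 := hright j (by omega)
    have := hRnn (a - j) j (by omega)
    have := hRnn (a - (j + 1)) (j + 1) (by omega)
    have := hLnn j
    have := hLnn (j + 1)
    rw [hH, hH]
    omega
  · intro j hj
    have := hLnn j
    rw [hH]; omega
  · rintro j hj ⟨h1, h3⟩
    have := hleft j hj
    have h2 := hright j hj
    rw [hH]; omega
  · intro j hj hv
    have h1 := hleft j hj
    have h2 := hright j hj
    unfold IsValley at hv
    omega
  · intro j hj hp hp'
    have h1 := hleft j (by omega)
    have h2 := hright j (by omega)
    have h3 := hright (j + 1) (by omega)
    have := hRnn (a - j) j (by omega)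
    have := hRnn (a - (j + 1)) (j + 1) (by omega)
    have := hLnn j
    have := hLnn (j + 1)
    unfold IsPeak at hp hp'
    simp only [Nat.add_sub_cancel] at hp'
    rw [hH, hH]
    rcases h2 with h2 | h2
    · rw [abs_eq (by norm_num)]; left; omega
    · rw [abs_eq (by norm_num)]; right; omega
  · intro j hj i hi c hc1 hc2 hc3 hc4
    have h1 := hleft j hj
    have h2 := hright j hj
    have hl := hLh j hj
    have hr := hRh (a - j - 1) j (by omega)
    have := hLnn j
    have := hRnn (a - j) j (by omega)
    have hBi := hB i hi
    have := hαt (j + 1) (by omega)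
    have := hβt (a - j) j (by omega)
    have h5 : i < j → t (i + 1) ≤ t j := fun hij => le_of_forall_lt_succ ht hij (by omega)
    have h6 : j < i → t (j + 1) ≤ t i := fun hij => le_of_forall_lt_succ ht hij (by omega)
    have := ht j hj
    have hup : j < i → t i < β (j + 1) → h (j + 1) ≤ h i :=
      fun hij hlt => up (i - (j + 1)) (j + 1) i (by omega) hi hlt
    have hdn : i ≤ j → α j < t (i + 1) → h j ≤ h i :=
      fun hij hlt => down (j - i) j i (by omega) hj hlt
    have key : (L j = 0 ∧ R j = 0) ∨ h j ≤ h i := by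
      rcases h1 with h1 | h1 <;> rcases h2 with h2 | h2
      · left; omega
      · right
        have : ¬ j < i := by omega
        exact hdn (by omega) (by omega)
      · right
        rcases lt_trichotomy j i with h7 | h7 | h7
        · have := hup h7 (by omega); omega
        · rw [h7]
        · have := h5 h7; omega
      · right
        rcases lt_trichotomy j i with h7 | h7 | h7
        · have := h6 h7; omega
        · rw [h7]
        · have := h5 h7; omega
    rw [hH]
    rcases key with key | key <;> omega

/-- The `r`-th vertex of a rightward chain whose horizontal edges have heights `h` and
breakpoints `t`. -/
def chainVertex (t h : ℕ → ℤ) (r : ℕ) : ℤ × ℤ := (t ((r + 1) / 2), h (r / 2))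

lemma chainVertex_even (t h : ℕ → ℤ) (j : ℕ) : chainVertex t h (2 * j) = (t j, h j) := by
  have h1 : (2 * j + 1) / 2 = j := by omega
  have h2 : 2 * j / 2 = j := by omega
  simp [chainVertex, h1, h2]

lemma chainVertex_odd (t h : ℕ → ℤ) (j : ℕ) :
    chainVertex t h (2 * j + 1) = (t (j + 1), h j) := by
  have h1 : (2 * j + 1 + 1) / 2 = j + 1 := by omega
  have h2 : (2 * j + 1) / 2 = j := by omega
  simp [chainVertex, h1, h2]

/-- `p` lies on the `r`-th edge of a chain. -/
def OnChainEdge (t h : ℕ → ℤ) (r : ℕ) (p : ℤ × ℤ) : Prop :=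
  onSeg (chainVertex t h r) (chainVertex t h (r + 1)) p

lemma onChainEdge_even {t h : ℕ → ℤ} {j : ℕ} (hj : t j < t (j + 1)) {p : ℤ × ℤ} :
    OnChainEdge t h (2 * j) p ↔ t j ≤ p.1 ∧ p.1 ≤ t (j + 1) ∧ p.2 = h j := by
  simp only [OnChainEdge, chainVertex_even, chainVertex_odd, onSeg]
  omega

lemma onChainEdge_odd {t h : ℕ → ℤ} {j : ℕ} {p : ℤ × ℤ} :
    OnChainEdge t h (2 * j + 1) p ↔
      p.1 = t (j + 1) ∧ min (h j) (h (j + 1)) ≤ p.2 ∧ p.2 ≤ max (h j) (h (j + 1)) := by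
  have : 2 * j + 1 + 1 = 2 * (j + 1) := by ring
  simp only [OnChainEdge, this, chainVertex_even, chainVertex_odd, onSeg]
  omega

lemma eq_vertex_of_onChainEdge {a : ℕ} {t h : ℕ → ℤ} (ht : ∀ j < a, t j < t (j + 1))
    (hne : ∀ j, j + 1 < a → h j ≠ h (j + 1)) {r r' : ℕ} (hr : r < r') (hr' : r' < 2 * a)
    {p : ℤ × ℤ} (hp : OnChainEdge t h r p) (hp' : OnChainEdge t h r' p) :
    r' = r + 1 ∧ p = chainVertex t h r' := by
  have lt := fun i j hij hj => lt_of_forall_lt_succ (i := i) (j := j) ht hij hj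
  obtain ⟨j, hj | hj⟩ := Nat.even_or_odd' r <;> obtain ⟨i, hi | hi⟩ := Nat.even_or_odd' r' <;>
    subst hj <;> subst hi
  · rw [onChainEdge_even (ht _ (by omega))] at hp hp'
    exfalso
    by_cases hij : i = j + 1
    · subst hij; have := hne j (by omega); omega
    · have := lt (j + 1) i (by omega) (by omega); omega
  · rw [onChainEdge_even (ht _ (by omega))] at hp
    rw [onChainEdge_odd] at hp'
    by_cases hij : i = j
    · subst hij
      refine ⟨rfl, ?_⟩
      rw [chainVertex_odd]
      exact Prod.ext hp'.1 hp.2.2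
    · have := lt (j + 1) (i + 1) (by omega) (by omega); omega
  · rw [onChainEdge_even (ht _ (by omega))] at hp'
    rw [onChainEdge_odd] at hp
    by_cases hij : i = j + 1
    · subst hij
      refine ⟨by ring, ?_⟩
      rw [chainVertex_even]
      exact Prod.ext hp.1 hp'.2.2
    · have := lt (j + 1) i (by omega) (by omega); omega
  · rw [onChainEdge_odd] at hp hp'
    have := lt (j + 1) (i + 1) (by omega) (by omega); omega

/-- A lower chain `(t, h)` with `a` horizontal edges and an upper chain with `b` horizontal
edges, closing up to a cyclic sequence. The upper chain is recorded by `(s, g)` after a point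
reflection in the origin, so that it runs rightwards as well. -/
structure ChainPair (a b : ℕ) (t h s g : ℕ → ℤ) : Prop where
  pos_left : 0 < a
  pos_right : 0 < b
  mono_left : ∀ j < a, t j < t (j + 1)
  mono_right : ∀ j < b, s j < s (j + 1)
  turn : s 0 = -t a
  close : s b = -t 0
  height_turn : h a = -g 0
  height_close : g b = -h 0
  ne_left : ∀ j, j + 1 < a → h j ≠ h (j + 1)
  ne_right : ∀ j, j + 1 < b → g j ≠ g (j + 1)

/-- The lower chain lies strictly below the upper one. -/
def Separated (a b : ℕ) (t h s g : ℕ → ℤ) : Prop :=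
  ∀ j < a, ∀ i < b, t j ≤ -s i → -s (i + 1) ≤ t (j + 1) → h j < -g i

lemma ChainPair.swap {a b : ℕ} {t h s g : ℕ → ℤ} (H : ChainPair a b t h s g) :
    ChainPair b a s g t h :=
  ⟨H.pos_right, H.pos_left, H.mono_right, H.mono_left, by have := H.close; omega,
    by have := H.turn; omega, by have := H.height_close; omega,
    by have := H.height_turn; omega, H.ne_right, H.ne_left⟩

lemma Separated.swap {a b : ℕ} {t h s g : ℕ → ℤ} (H : Separated a b t h s g) :
    Separated b a s g t h := by
  intro i hi j hj h1 h2
  have := H j hj i hi (by omega) (by omega)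
  omega

lemma ChainPair.last_lt {a b : ℕ} {t h s g : ℕ → ℤ} (H : ChainPair a b t h s g)
    (S : Separated a b t h s g) : h (a - 1) < h a := by
  have h1 := H.pos_left
  have h2 := H.turn
  have h3 := H.mono_left (a - 1) (by omega)
  have h4 := H.mono_right 0 H.pos_right
  have h5 := S (a - 1) (by omega) 0 H.pos_right
  rw [Nat.sub_add_cancel h1] at h3 h5
  rw [H.height_turn]
  exact h5 (by omega) (by omega)

/-- A point on an inner edge of a chain lies weakly below some horizontal edge of the chain. -/
lemma exists_below_of_onChainEdge {a : ℕ} {t h : ℕ → ℤ} (ht : ∀ j < a, t j < t (j + 1))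
    {r : ℕ} (hr : r + 1 < 2 * a) {p : ℤ × ℤ} (hp : OnChainEdge t h r p) :
    ∃ j < a, t j ≤ p.1 ∧ p.1 ≤ t (j + 1) ∧ p.2 ≤ h j := by
  obtain ⟨j, rfl | rfl⟩ := Nat.even_or_odd' r
  · rw [onChainEdge_even (ht _ (by omega))] at hp
    exact ⟨j, by omega, by omega⟩
  · rw [onChainEdge_odd] at hp
    have := ht j (by omega)
    have := ht (j + 1) (by omega)
    rcases le_total (h j) (h (j + 1)) with h1 | h1
    · exact ⟨j + 1, by omega, by omega⟩
    · exact ⟨j, by omega, by omega⟩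

lemma le_fst_of_onChainEdge {a : ℕ} {t h : ℕ → ℤ} (ht : ∀ j < a, t j < t (j + 1))
    {r : ℕ} (hr : r < 2 * a) {p : ℤ × ℤ} (hp : OnChainEdge t h r p) :
    t ((r + 1) / 2) ≤ p.1 ∧ p.1 ≤ t ((r + 2) / 2) := by
  have := le_of_forall_lt_succ ht (show (r + 1) / 2 ≤ (r + 2) / 2 by omega) (by omega)
  simp only [OnChainEdge, onSeg, chainVertex, add_assoc, Nat.reduceAdd] at hp
  omega

lemma cross_chain_aux {a b : ℕ} {t h s g : ℕ → ℤ} (H : ChainPair a b t h s g)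
    {q : ℕ} (hq : q < 2 * b) {p : ℤ × ℤ}
    (hp : OnChainEdge t h (2 * a - 1) p) (hp' : OnChainEdge s g q (-p)) :
    q = 0 ∧ -p = chainVertex s g 0 := by
  obtain ⟨a, rfl⟩ : ∃ k, a = k + 1 := ⟨a - 1, by have := H.pos_left; omega⟩
  have e : 2 * (a + 1) - 1 = 2 * a + 1 := by omega
  rw [e, onChainEdge_odd] at hp
  have h1 := le_fst_of_onChainEdge H.mono_right hq hp'
  have h2 := H.turn
  rcases Nat.eq_zero_or_pos q with rfl | h0
  · have h3 := (onChainEdge_even (j := 0) (H.mono_right 0 H.pos_right)).1 hp'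
    refine ⟨rfl, Prod.ext ?_ ?_⟩
    · simp [chainVertex]; omega
    · simpa [chainVertex] using h3.2.2
  · have h3 := lt_of_forall_lt_succ H.mono_right (show 0 < (q + 1) / 2 by omega) (by omega)
    simp only [Prod.fst_neg] at h1
    omega

lemma cross_chain {a b : ℕ} {t h s g : ℕ → ℤ} (H : ChainPair a b t h s g)
    (S : Separated a b t h s g) {r q : ℕ} (hr : r < 2 * a) (hq : q < 2 * b) {p : ℤ × ℤ}
    (hp : OnChainEdge t h r p) (hp' : OnChainEdge s g q (-p)) :
    (r + 1 = 2 * a ∧ q = 0 ∧ -p = chainVertex s g 0) ∨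
      (q + 1 = 2 * b ∧ r = 0 ∧ p = chainVertex t h 0) := by
  by_cases h1 : r + 1 = 2 * a
  · left
    obtain rfl : r = 2 * a - 1 := by omega
    exact ⟨h1, cross_chain_aux H hq hp hp'⟩
  by_cases h2 : q + 1 = 2 * b
  · right
    obtain rfl : q = 2 * b - 1 := by omega
    have := cross_chain_aux H.swap hr hp' (by simpa using hp)
    exact ⟨h2, by simpa using this⟩
  exfalso
  obtain ⟨j, hj, h3⟩ := exists_below_of_onChainEdge H.mono_left (by omega) hp
  obtain ⟨i, hi, h4⟩ := exists_below_of_onChainEdge H.mono_right (by omega) hp'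
  simp only [Prod.fst_neg, Prod.snd_neg] at h4
  have := S j hj i hi (by omega) (by omega)
  omega

/-- The vertices of the closed walk along a pair of chains. -/
def walkVertex (a : ℕ) (t h s g : ℕ → ℤ) (r : ℕ) : ℤ × ℤ :=
  if r < 2 * a then chainVertex t h r else -chainVertex s g (r - 2 * a)

lemma onSeg_neg {u w p : ℤ × ℤ} : onSeg (-u) (-w) p ↔ onSeg u w (-p) := by
  simp only [onSeg, Prod.fst_neg, Prod.snd_neg]
  omega

lemma ChainPair.walkVertex_left {a b : ℕ} {t h s g : ℕ → ℤ} (H : ChainPair a b t h s g)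
    {r : ℕ} (hr : r ≤ 2 * a) : walkVertex a t h s g r = chainVertex t h r := by
  rcases hr.eq_or_lt with rfl | hr
  · have h1 := H.turn
    have h2 := H.height_turn
    rw [walkVertex, if_neg (by omega), chainVertex_even]
    simp [chainVertex, h1, h2]
  · rw [walkVertex, if_pos hr]

lemma walkVertex_right {a : ℕ} {t h s g : ℕ → ℤ} (r : ℕ) :
    walkVertex a t h s g (2 * a + r) = -chainVertex s g r := by
  rw [walkVertex, if_neg (by omega), Nat.add_sub_cancel_left]

lemma ChainPair.walkVertex_last {a b : ℕ} {t h s g : ℕ → ℤ} (H : ChainPair a b t h s g) :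
    walkVertex a t h s g (2 * a + 2 * b) = walkVertex a t h s g 0 := by
  have h1 := H.close
  have h2 := H.height_close
  rw [walkVertex_right, chainVertex_even, H.walkVertex_left (by omega)]
  simp [chainVertex, h1, h2]

lemma ChainPair.walk_simple {a b : ℕ} {t h s g : ℕ → ℤ} (H : ChainPair a b t h s g)
    (S : Separated a b t h s g) {r r' : ℕ} (hr : r < r') (hr' : r' < 2 * a + 2 * b) {p : ℤ × ℤ}
    (hp : onSeg (walkVertex a t h s g r) (walkVertex a t h s g (r + 1)) p)
    (hp' : onSeg (walkVertex a t h s g r') (walkVertex a t h s g (r' + 1)) p) :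
    (r' = r + 1 ∧ p = walkVertex a t h s g r') ∨
      (r = 0 ∧ r' + 1 = 2 * a + 2 * b ∧ p = walkVertex a t h s g 0) := by
  by_cases h1 : r < 2 * a
  · rw [H.walkVertex_left (by omega), H.walkVertex_left (by omega)] at hp
    by_cases h2 : r' < 2 * a
    · rw [H.walkVertex_left (by omega), H.walkVertex_left (by omega)] at hp'
      left
      have := eq_vertex_of_onChainEdge H.mono_left H.ne_left hr h2 hp hp'
      rwa [H.walkVertex_left (by omega)]
    · obtain ⟨q, rfl⟩ := Nat.exists_eq_add_of_le (not_lt.1 h2)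
      rw [add_assoc, walkVertex_right, walkVertex_right, onSeg_neg] at hp'
      rw [walkVertex_right, H.walkVertex_left (by omega)]
      rcases cross_chain H S h1 (by omega) hp hp' with ⟨h3, rfl, h4⟩ | ⟨h3, h4, h5⟩
      · left; exact ⟨by omega, by rw [← h4, neg_neg]⟩
      · right; exact ⟨h4, by omega, h5⟩
  · obtain ⟨q, rfl⟩ := Nat.exists_eq_add_of_le (not_lt.1 h1)
    obtain ⟨q', rfl⟩ := Nat.exists_eq_add_of_le (show 2 * a ≤ r' by omega)
    rw [add_assoc, walkVertex_right, walkVertex_right, onSeg_neg] at hp hp'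
    left
    have := eq_vertex_of_onChainEdge H.mono_right H.ne_right (by omega) (by omega) hp hp'
    rw [walkVertex_right, ← this.2]
    exact ⟨by omega, by simp⟩

lemma exists_column {a : ℕ} {t : ℕ → ℤ} {c : ℤ} (h0 : t 0 ≤ c) (ha : c < t a) :
    ∃ j < a, t j ≤ c ∧ c < t (j + 1) := by
  induction a with
  | zero => omega
  | succ a ih =>
    by_cases h : c < t a
    · obtain ⟨j, hj, h1⟩ := ih h
      exact ⟨j, by omega, h1⟩
    · exact ⟨a, by omega, by omega, ha⟩

lemma column_unique {a : ℕ} {t : ℕ → ℤ} (ht : ∀ j < a, t j < t (j + 1)) {i j : ℕ} (hi : i < a)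
    (hj : j < a) {c : ℤ} (h1 : t i ≤ c) (h2 : c < t (i + 1)) (h3 : t j ≤ c)
    (h4 : c < t (j + 1)) : i = j := by
  rcases lt_trichotomy i j with h | h | h
  · have := le_of_forall_lt_succ ht (show i + 1 ≤ j from h) (by omega); omega
  · exact h
  · have := le_of_forall_lt_succ ht (show j + 1 ≤ i from h) (by omega); omega

/-- Moving both chains of a pair away from each other keeps them separated. -/
lemma Separated.of_dominated {a b : ℕ} {t h s g t' h' s' g' : ℕ → ℤ}
    (S : Separated a b t h s g)
    (ht' : ∀ j < a, t' j < t' (j + 1)) (hs' : ∀ j < b, s' j < s' (j + 1))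
    (ht0 : t' 0 = t 0) (hta : t' a = t a) (hs0 : s' 0 = s 0) (hsb : s' b = s b)
    (hh : ∀ j < a, ∀ i < a, ∀ c, t' j ≤ c → c < t' (j + 1) → t i ≤ c → c < t (i + 1) →
        h' j ≤ h i)
    (hg : ∀ j < b, ∀ i < b, ∀ c, s' j ≤ c → c < s' (j + 1) → s i ≤ c → c < s (i + 1) →
        g' j ≤ g i) : Separated a b t' h' s' g' := by
  intro j hj i hi h1 h2
  have h3 := ht' j hj
  have h4 := hs' i hi
  obtain ⟨c, d, hc1, hc2, hd1, hd2, hcd⟩ : ∃ c d : ℤ, t' j ≤ c ∧ c < t' (j + 1) ∧ s' i ≤ d ∧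
      d < s' (i + 1) ∧ (-1 - d = c ∨ -1 - d = c + 1 ∨ -1 - d = c - 1) := by
    by_cases h5 : t' (j + 1) = -s' (i + 1)
    · exact ⟨t' (j + 1) - 1, s' (i + 1) - 1, by omega⟩
    · by_cases h6 : t' j = -s' i
      · exact ⟨t' j, s' i, by omega⟩
      · refine ⟨max (t' j) (-s' (i + 1)), -1 - max (t' j) (-s' (i + 1)), ?_⟩
        omega
  have t1 := le_of_forall_lt_succ ht' (show 0 ≤ j by omega) (by omega)
  have t2 := le_of_forall_lt_succ ht' (show j + 1 ≤ a by omega) le_rfl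
  have t3 := le_of_forall_lt_succ hs' (show 0 ≤ i by omega) (by omega)
  have t4 := le_of_forall_lt_succ hs' (show i + 1 ≤ b by omega) le_rfl
  obtain ⟨j₀, hj₀, h5, h6⟩ := exists_column (t := t) (a := a) (c := c) (by omega) (by omega)
  obtain ⟨i₀, hi₀, h7, h8⟩ := exists_column (t := s) (a := b) (c := d) (by omega) (by omega)
  have e1 := hh j hj j₀ hj₀ c hc1 hc2 h5 h6
  have e2 := hg i hi i₀ hi₀ d hd1 hd2 h7 h8
  have e3 := S j₀ hj₀ i₀ hi₀ (by omega) (by omega)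
  omega

/-- The height of a chain over the unit column starting at `c`. -/
def columnHeight (a : ℕ) (t h : ℕ → ℤ) (c : ℤ) : ℤ :=
  ∑ j ∈ Finset.range a, if t j ≤ c ∧ c < t (j + 1) then h j else 0

lemma columnHeight_eq {a : ℕ} {t h : ℕ → ℤ} (ht : ∀ j < a, t j < t (j + 1)) {j : ℕ}
    (hj : j < a) {c : ℤ} (h1 : t j ≤ c) (h2 : c < t (j + 1)) : columnHeight a t h c = h j := by
  rw [columnHeight, Finset.sum_eq_single j, if_pos ⟨h1, h2⟩]
  · intro i hi hij
    rw [if_neg]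
    rintro ⟨h3, h4⟩
    exact hij (column_unique ht (Finset.mem_range.1 hi) hj h3 h4 h1 h2)
  · intro h3; simp [hj] at h3

lemma sum_columnHeight {a : ℕ} {t h : ℕ → ℤ} (ht : ∀ j < a, t j < t (j + 1)) :
    ∑ c ∈ Finset.Ico (t 0) (t a), columnHeight a t h c =
      ∑ j ∈ Finset.range a, h j * (t (j + 1) - t j) := by
  simp only [columnHeight]
  rw [Finset.sum_comm]
  refine Finset.sum_congr rfl fun j hj => ?_
  rw [Finset.mem_range] at hj
  have h1 := le_of_forall_lt_succ ht (Nat.zero_le j) (by omega)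
  have h2 := le_of_forall_lt_succ ht (show j + 1 ≤ a by omega) le_rfl
  have h3 := ht j hj
  rw [← Finset.sum_filter]
  have : (Finset.Ico (t 0) (t a)).filter (fun c => t j ≤ c ∧ c < t (j + 1)) =
      Finset.Ico (t j) (t (j + 1)) := by
    ext c; simp only [Finset.mem_filter, Finset.mem_Ico]; omega
  rw [this, Finset.sum_const, Int.card_Ico, nsmul_eq_mul, Int.toNat_of_nonneg (by omega)]
  ring

/-- Minus the area enclosed by a pair of chains, as a sum over unit columns. -/
lemma ChainPair.sum_heights {a b : ℕ} {t h s g : ℕ → ℤ} (H : ChainPair a b t h s g) :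
    ∑ j ∈ Finset.range a, h j * (t (j + 1) - t j) +
      ∑ i ∈ Finset.range b, g i * (s (i + 1) - s i) =
    ∑ c ∈ Finset.Ico (t 0) (t a), (columnHeight a t h c + columnHeight b s g (-1 - c)) := by
  rw [Finset.sum_add_distrib, sum_columnHeight H.mono_left, ← sum_columnHeight H.mono_right]
  congr 1
  have h1 := H.turn
  have h2 := H.close
  refine Finset.sum_bij' (fun c _ => -1 - c) (fun c _ => -1 - c) ?_ ?_ ?_ ?_ ?_ <;>
    intro c hc <;> simp only [Finset.mem_Ico] at * <;> try omega
  rw [sub_sub_cancel]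

lemma ChainPair.sum_heights_neg {a b : ℕ} {t h s g : ℕ → ℤ} (H : ChainPair a b t h s g)
    (S : Separated a b t h s g) :
    ∑ j ∈ Finset.range a, h j * (t (j + 1) - t j) +
      ∑ i ∈ Finset.range b, g i * (s (i + 1) - s i) < 0 := by
  rw [H.sum_heights]
  refine Finset.sum_neg (fun c hc => ?_) ?_
  · rw [Finset.mem_Ico] at hc
    have h1 := H.turn
    have h2 := H.close
    obtain ⟨j, hj, h3, h4⟩ := exists_column hc.1 hc.2
    obtain ⟨i, hi, h5, h6⟩ := exists_column (t := s) (a := b) (c := -1 - c)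
      (by omega) (by omega)
    rw [columnHeight_eq H.mono_left hj h3 h4, columnHeight_eq H.mono_right hi h5 h6]
    have := S j hj i hi (by omega) (by omega)
    omega
  · rw [Finset.nonempty_Ico]
    exact lt_of_forall_lt_succ H.mono_left H.pos_left le_rfl

/-- Over the common abscissa of two neighbouring columns a chain contains a full vertical
segment joining its two heights. -/
lemma exists_onChainEdge_between {a : ℕ} {t h : ℕ → ℤ} (ht : ∀ j < a, t j < t (j + 1))
    {c y : ℤ} {j j' : ℕ} (hj : j < a) (hj' : j' < a) (h1 : t j ≤ c) (h2 : c < t (j + 1))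
    (h3 : t j' ≤ c + 1) (h4 : c + 1 < t (j' + 1)) (hy : min (h j) (h j') ≤ y)
    (hy' : y ≤ max (h j) (h j')) :
    ∃ r, r + 1 < 2 * a ∧ OnChainEdge t h r (c + 1, y) := by
  have h5 := ht j hj
  by_cases hjj : c + 1 = t (j + 1)
  · have hja : j + 1 < a := by
      by_contra h6
      have := le_of_forall_lt_succ ht (show j' + 1 ≤ j + 1 by omega) (by omega)
      omega
    have := ht (j + 1) hja
    obtain rfl : j' = j + 1 := column_unique ht hj' hja h3 h4 (by omega) (by omega)
    refine ⟨2 * j + 1, by omega, ?_⟩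
    rw [onChainEdge_odd]
    exact ⟨hjj, hy, hy'⟩
  · obtain rfl : j' = j := column_unique ht hj' hj h3 h4 (by omega) (by omega)
    refine ⟨2 * j', by omega, ?_⟩
    rw [onChainEdge_even h5]
    refine ⟨by simp only; omega, by simp only; omega, ?_⟩
    simpa using le_antisymm hy' hy

/-- Two disjoint chains enclosing positive area are separated. -/
lemma ChainPair.separated {a b : ℕ} {t h s g : ℕ → ℤ} (H : ChainPair a b t h s g)
    (hdisj : ∀ r q, r + 1 < 2 * a → q + 1 < 2 * b → ∀ p, OnChainEdge t h r p →
      ¬ OnChainEdge s g q (-p))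
    (harea : ∑ j ∈ Finset.range a, h j * (t (j + 1) - t j) +
      ∑ i ∈ Finset.range b, g i * (s (i + 1) - s i) < 0) : Separated a b t h s g := by
  have hturn := H.turn
  have hclose := H.close
  have locL : ∀ c, t 0 ≤ c → c < t a → ∃ j < a, t j ≤ c ∧ c < t (j + 1) :=
    fun c h1 h2 => exists_column h1 h2
  have locR : ∀ c, t 0 ≤ c → c < t a → ∃ i < b, s i ≤ -1 - c ∧ -1 - c < s (i + 1) :=
    fun c h1 h2 => exists_column (by omega) (by omega)
  have nbr : ∀ c j i j' i', j < a → i < b → j' < a → i' < b → t j ≤ c → c < t (j + 1) →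
      t j' ≤ c + 1 → c + 1 < t (j' + 1) → s i ≤ -1 - c → -1 - c < s (i + 1) →
      s i' ≤ -1 - (c + 1) → -1 - (c + 1) < s (i' + 1) →
      max (h j) (h j') < min (-g i) (-g i') ∨ max (-g i) (-g i') < min (h j) (h j') := by
    intro c j i j' i' hj hi hj' hi' h1 h2 h3 h4 h5 h6 h7 h8
    by_contra hcon
    obtain ⟨y, hy1, hy2, hy3, hy4⟩ : ∃ y, min (h j) (h j') ≤ y ∧ y ≤ max (h j) (h j') ∧
        min (g i') (g i) ≤ -y ∧ -y ≤ max (g i') (g i) :=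
      ⟨max (min (h j) (h j')) (min (-g i) (-g i')), by omega⟩
    obtain ⟨r, hr, hr'⟩ := exists_onChainEdge_between H.mono_left hj hj' h1 h2 h3 h4 hy1 hy2
    obtain ⟨q, hq, hq'⟩ := exists_onChainEdge_between H.mono_right (c := -1 - (c + 1)) hi' hi
      h7 h8 (by omega) (by omega) hy3 hy4
    refine hdisj r q hr hq _ hr' ?_
    convert hq' using 1
    ext
    · simp only [Prod.fst_neg]; ring
    · simp
  have step : ∀ k : ℕ, t 0 + k < t a →
      ((columnHeight a t h (t 0) < -columnHeight b s g (-1 - t 0)) ↔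
        (columnHeight a t h (t 0 + k) < -columnHeight b s g (-1 - (t 0 + k)))) := by
    intro k
    induction k with
    | zero => simp
    | succ k ih =>
      intro hk
      push_cast at hk ⊢
      rw [ih (by omega), ← add_assoc]
      obtain ⟨j, hj, h1, h2⟩ := locL (t 0 + k) (by omega) (by omega)
      obtain ⟨j', hj', h3, h4⟩ := locL (t 0 + k + 1) (by omega) (by omega)
      obtain ⟨i, hi, h5, h6⟩ := locR (t 0 + k) (by omega) (by omega)
      obtain ⟨i', hi', h7, h8⟩ := locR (t 0 + k + 1) (by omega) (by omega)
      rw [columnHeight_eq H.mono_left hj h1 h2, columnHeight_eq H.mono_left hj' h3 h4,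
        columnHeight_eq H.mono_right hi h5 h6, columnHeight_eq H.mono_right hi' h7 h8]
      have := nbr _ j i j' i' hj hi hj' hi' h1 h2 h3 h4 h5 h6 h7 h8
      omega
  have base : columnHeight a t h (t 0) < -columnHeight b s g (-1 - t 0) := by
    by_contra hcon
    rw [H.sum_heights] at harea
    refine absurd harea (not_lt.2 (Finset.sum_nonneg fun c hc => ?_))
    rw [Finset.mem_Ico] at hc
    obtain ⟨k, rfl⟩ := Int.le.dest hc.1
    have := step k hc.2
    omega
  have col : ∀ c j i, j < a → i < b → t j ≤ c → c < t (j + 1) → s i ≤ -1 - c →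
      -1 - c < s (i + 1) → h j < -g i := by
    intro c j i hj hi h1 h2 h3 h4
    have t1 := le_of_forall_lt_succ H.mono_left (Nat.zero_le j) (by omega)
    have t2 := le_of_forall_lt_succ H.mono_left (show j + 1 ≤ a by omega) le_rfl
    obtain ⟨k, rfl⟩ := Int.le.dest (t1.trans h1)
    have := (step k (by omega)).1 base
    rwa [columnHeight_eq H.mono_left hj h1 h2, columnHeight_eq H.mono_right hi h3 h4] at this
  have adj : ∀ c j i j' i', j < a → i < b → j' < a → i' < b → t j ≤ c → c < t (j + 1) →
      t j' ≤ c + 1 → c + 1 < t (j' + 1) → s i ≤ -1 - c → -1 - c < s (i + 1) →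
      s i' ≤ -1 - (c + 1) → -1 - (c + 1) < s (i' + 1) →
      h j < -g i' ∧ h j' < -g i := by
    intro c j i j' i' hj hi hj' hi' h1 h2 h3 h4 h5 h6 h7 h8
    have := nbr _ j i j' i' hj hi hj' hi' h1 h2 h3 h4 h5 h6 h7 h8
    have := col c j i hj hi h1 h2 h5 h6
    omega
  intro j hj i hi h1 h2
  have t0 := H.mono_left j hj
  have s0 := H.mono_right i hi
  have t1 := le_of_forall_lt_succ H.mono_left (Nat.zero_le j) (by omega)
  have t2 := le_of_forall_lt_succ H.mono_left (show j + 1 ≤ a by omega) le_rfl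
  have s1 := le_of_forall_lt_succ H.mono_right (Nat.zero_le i) (by omega)
  have s2 := le_of_forall_lt_succ H.mono_right (show i + 1 ≤ b by omega) le_rfl
  by_cases h5 : t (j + 1) = -s (i + 1)
  · obtain ⟨j', hj', h3, h4⟩ := locL (t (j + 1) - 1 + 1) (by omega) (by omega)
    obtain ⟨i', hi', h6, h7⟩ := locR (t (j + 1) - 1) (by omega) (by omega)
    exact (adj (t (j + 1) - 1) j i' j' i hj hi' hj' hi (by omega) (by omega) h3 h4 h6 h7
      (by omega) (by omega)).1
  · by_cases h6 : t j = -s i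
    · obtain ⟨j', hj', h3, h4⟩ := locL (t j - 1) (by omega) (by omega)
      obtain ⟨i', hi', h7, h8⟩ := locR (t j - 1 + 1) (by omega) (by omega)
      exact (adj (t j - 1) j' i j i' hj' hi hj hi' h3 h4 (by omega) (by omega) (by omega)
        (by omega) h7 h8).2
    · exact col (max (t j) (-s (i + 1))) j i hj hi (by omega) (by omega) (by omega) (by omega)

/-- From index `u` on, the walk `w` follows the chain `(t, h)` with `a` horizontal edges, up to
the factor `ε`. -/
def FollowsChain {n : ℕ} (w : ZMod n → ℤ × ℤ) (u : ZMod n) (ε : ℤ) (a : ℕ) (t h : ℕ → ℤ) : Prop :=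
  ∀ r ≤ 2 * a, w (u + (r : ZMod n)) = (ε * (chainVertex t h r).1, ε * (chainVertex t h r).2)

lemma FollowsChain.even {n : ℕ} {w : ZMod n → ℤ × ℤ} {u : ZMod n} {ε : ℤ} {a : ℕ}
    {t h : ℕ → ℤ} (F : FollowsChain w u ε a t h) {j : ℕ} (hj : j ≤ a) {i : ZMod n}
    (hi : i = u + ((2 * j : ℕ) : ZMod n)) : w i = (ε * t j, ε * h j) := by
  rw [hi, F _ (by omega), chainVertex_even]

lemma FollowsChain.odd {n : ℕ} {w : ZMod n → ℤ × ℤ} {u : ZMod n} {ε : ℤ} {a : ℕ}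
    {t h : ℕ → ℤ} (F : FollowsChain w u ε a t h) {j : ℕ} (hj : j < a) {i : ZMod n}
    (hi : i = u + ((2 * j + 1 : ℕ) : ZMod n)) : w i = (ε * t (j + 1), ε * h j) := by
  rw [hi, F _ (by omega), chainVertex_odd]

section Turns

variable {n : ℕ} {P : RectPolygon n} {u : ZMod n} {ε : ℤ} {a : ℕ} {t h : ℕ → ℤ}

lemma FollowsChain.horiz_even (F : FollowsChain P.v u ε a t h) {j : ℕ} (hj : j < a)
    {i : ZMod n} (hi : i = u + ((2 * j : ℕ) : ZMod n)) : P.horiz i := by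
  rw [RectPolygon.horiz, F.odd hj (i := i + 1) (by rw [hi]; push_cast; ring), F.even hj.le hi]

lemma FollowsChain.dvec_even (F : FollowsChain P.v u ε a t h) {j : ℕ} (hj : j < a)
    {i : ZMod n} (hi : i = u + ((2 * j : ℕ) : ZMod n)) :
    P.dvec i = (ε * (t (j + 1) - t j), 0) := by
  rw [RectPolygon.dvec, F.odd hj (i := i + 1) (by rw [hi]; push_cast; ring), F.even hj.le hi]
  ext <;> simp [mul_sub]

lemma FollowsChain.dvec_odd (F : FollowsChain P.v u ε a t h) {j : ℕ} (hj : j < a)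
    {i : ZMod n} (hi : i = u + ((2 * j + 1 : ℕ) : ZMod n)) :
    P.dvec i = (0, ε * (h (j + 1) - h j)) := by
  rw [RectPolygon.dvec, F.even (j := j + 1) hj (i := i + 1) (by rw [hi]; push_cast; ring),
    F.odd hj hi]
  ext <;> simp [mul_sub]

lemma FollowsChain.cross_odd (F : FollowsChain P.v u ε a t h) (hε : ε * ε = 1) {j : ℕ}
    (hj : j < a) {i : ZMod n} (hi : i = u + ((2 * j + 1 : ℕ) : ZMod n)) :
    cross (P.dvec (i - 1)) (P.dvec i) = (t (j + 1) - t j) * (h (j + 1) - h j) := by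
  rw [F.dvec_odd hj hi, F.dvec_even hj (i := i - 1) (by rw [hi]; push_cast; ring), cross]
  linear_combination (t (j + 1) - t j) * (h (j + 1) - h j) * hε

lemma FollowsChain.cross_even (F : FollowsChain P.v u ε a t h) (hε : ε * ε = 1) {j : ℕ}
    (hj : j + 1 < a) {i : ZMod n} (hi : i = u + ((2 * (j + 1) : ℕ) : ZMod n)) :
    cross (P.dvec (i - 1)) (P.dvec i) = (t (j + 1 + 1) - t (j + 1)) * (h j - h (j + 1)) := by
  rw [F.dvec_even hj hi,
    F.dvec_odd (j := j) (by omega) (i := i - 1) (by rw [hi]; push_cast; ring), cross]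
  linear_combination (t (j + 1 + 1) - t (j + 1)) * (h j - h (j + 1)) * hε

/-- Outer extreme edges correspond to valleys. -/
lemma FollowsChain.outerExtreme_iff (F : FollowsChain P.v u ε a t h) (hε : ε * ε = 1)
    (ht : ∀ j < a, t j < t (j + 1)) (hu : P.convexAt u) {j : ℕ} (hj : j < a) {i : ZMod n}
    (hi : i = u + ((2 * j : ℕ) : ZMod n)) : outerExtreme P i ↔ IsValley h j := by
  have h1 : P.convexAt (i + 1) ↔ h j < h (j + 1) := by
    rw [RectPolygon.convexAt, F.cross_odd hε hj (by rw [hi]; push_cast; ring),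
      mul_pos_iff_of_pos_left (sub_pos.2 (ht j hj)), sub_pos]
  have h2 : P.convexAt i ↔ (j = 0 ∨ h j < h (j - 1)) := by
    rcases j with _ | j
    · simpa [hi] using hu
    · rw [RectPolygon.convexAt, F.cross_even hε hj hi,
        mul_pos_iff_of_pos_left (sub_pos.2 (ht _ hj)), sub_pos]
      simp
  rw [outerExtreme, h1, h2, IsValley]
  exact and_iff_right (F.horiz_even hj hi)

/-- Peaks give inner extreme edges. -/
lemma FollowsChain.innerExtreme (F : FollowsChain P.v u ε a t h) (hε : ε * ε = 1)
    (ht : ∀ j < a, t j < t (j + 1)) {j : ℕ} (hj : j < a) {i : ZMod n}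
    (hi : i = u + ((2 * j : ℕ) : ZMod n)) (hp : IsPeak h j) : innerExtreme P i := by
  obtain ⟨h0, h1, h2⟩ := hp
  obtain ⟨j, rfl⟩ : ∃ k, j = k + 1 := ⟨j - 1, by omega⟩
  refine ⟨F.horiz_even hj hi, ?_, ?_⟩
  · rw [RectPolygon.reflexAt, F.cross_even hε hj hi]
    exact mul_neg_of_pos_of_neg (sub_pos.2 (ht _ hj)) (sub_neg.2 h1)
  · rw [RectPolygon.reflexAt, F.cross_odd hε hj (by rw [hi]; push_cast; ring)]
    exact mul_neg_of_pos_of_neg (sub_pos.2 (ht _ hj)) (sub_neg.2 h2)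

lemma FollowsChain.elen_odd (F : FollowsChain P.v u ε a t h) (hε : |ε| = 1) {j : ℕ}
    (hj : j < a) {i : ZMod n} (hi : i = u + ((2 * j + 1 : ℕ) : ZMod n)) :
    P.elen i = |h (j + 1) - h j| := by
  have := F.dvec_odd hj hi
  rw [RectPolygon.dvec, Prod.ext_iff] at this
  simp only [Prod.fst_sub, Prod.snd_sub] at this
  rw [RectPolygon.elen, this.1, this.2, abs_mul, hε]
  simp

lemma FollowsChain.elen_even (F : FollowsChain P.v u ε a t h) (hε : |ε| = 1) {j : ℕ}
    (hj : j < a) {i : ZMod n} (hi : i = u + ((2 * j : ℕ) : ZMod n)) :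
    P.elen i = |t (j + 1) - t j| := by
  have := F.dvec_even hj hi
  rw [RectPolygon.dvec, Prod.ext_iff] at this
  simp only [Prod.fst_sub, Prod.snd_sub] at this
  rw [RectPolygon.elen, this.1, this.2, abs_mul, hε]
  simp

lemma FollowsChain.canonical (F : FollowsChain P.v u ε a t h) (hε : |ε| = 1)
    (ht : ∀ j < a, t j < t (j + 1)) (hu : P.convexAt u) {B : ℤ}
    (hne : ∀ j < a, h j ≠ h (j + 1))
    (hB : ∀ j < a, IsValley h j → h j = B)
    (hlen : ∀ j < a, ¬ IsValley h j → t (j + 1) = t j + 1)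
    (hstep : ∀ j, j + 1 < a → ¬ IsPeak h j → ¬ IsPeak h (j + 1) → |h (j + 1) - h j| = 1)
    {r : ℕ} (hr : r < 2 * a) {i : ZMod n} (hi : i = u + (r : ZMod n)) :
    (outerExtreme P i → (P.v i).2 = ε * B) ∧
    (P.vert i → (P.v i).1 ≠ ε * t a → ¬ _root_.innerExtreme P (i - 1) →
      ¬ _root_.innerExtreme P (i + 1) → P.elen i = 1) ∧
    (P.horiz i → ¬ outerExtreme P i → P.elen i = 1) := by
  have hε' : ε * ε = 1 := by rw [← abs_mul_abs_self, hε, one_mul]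
  have hε0 : ε ≠ 0 := by rintro rfl; simp at hε
  obtain ⟨j, rfl | rfl⟩ := Nat.even_or_odd' r
  · have hj : j < a := by omega
    have hv := F.outerExtreme_iff hε' ht hu hj hi
    refine ⟨fun ho => ?_, fun hvert => ?_, fun _ ho => ?_⟩
    · rw [F.even hj.le hi, hB j hj (hv.1 ho)]
    · exfalso
      have h1 := F.dvec_even hj hi
      rw [RectPolygon.dvec, Prod.ext_iff] at h1
      simp only [Prod.fst_sub] at h1
      rw [RectPolygon.vert] at hvert
      rw [hvert, sub_self] at h1
      have := mul_ne_zero hε0 (sub_pos.2 (ht j hj)).ne'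
      exact this h1.1.symm
    · rw [F.elen_even hε hj hi, hlen j hj (mt hv.2 ho)]
      simp
  · have hj : j < a := by omega
    have hnh : ¬ P.horiz i := by
      intro hh
      have h1 := F.dvec_odd hj hi
      rw [RectPolygon.dvec, Prod.ext_iff] at h1
      simp only [Prod.snd_sub] at h1
      rw [RectPolygon.horiz] at hh
      rw [hh, sub_self] at h1
      exact mul_ne_zero hε0 (sub_ne_zero.2 (hne j hj).symm) h1.2.symm
    refine ⟨fun ho => absurd ho.1 hnh, fun _ hx h1 h2 => ?_, fun hh => absurd hh hnh⟩
    rw [F.odd hj hi] at hx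
    have hja : j + 1 < a := by
      rcases Nat.lt_or_ge (j + 1) a with h3 | h3
      · exact h3
      · obtain rfl : j + 1 = a := by omega
        exact absurd rfl hx
    rw [F.elen_odd hε hj hi]
    refine hstep j hja (fun hp => h1 ?_) (fun hp => h2 ?_)
    · exact F.innerExtreme hε' ht hj (by rw [hi]; push_cast; ring) hp
    · exact F.innerExtreme hε' ht hja (by rw [hi]; push_cast; ring) hp

end Turns

/-- The closed walk `w` follows, starting at index `u`, the pair of chains `(t, h)`, `(s, g)`. -/
structure FollowsPair {n : ℕ} (w : ZMod n → ℤ × ℤ) (u : ZMod n) (a b : ℕ) (t h s g : ℕ → ℤ) :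
    Prop where
  card : n = 2 * a + 2 * b
  pair : ChainPair a b t h s g
  left : FollowsChain w u 1 a t h
  right : FollowsChain w (u + ((2 * a : ℕ) : ZMod n)) (-1) b s g

lemma natCast_inj_of_lt {n r r' : ℕ} (hr : r < n) (hr' : r' < n) :
    (r : ZMod n) = r' ↔ r = r' := by
  rw [ZMod.natCast_eq_natCast_iff', Nat.mod_eq_of_lt hr, Nat.mod_eq_of_lt hr']

lemma sum_range_two_mul (a : ℕ) (f : ℕ → ℤ) :
    ∑ r ∈ Finset.range (2 * a), f r =
      ∑ j ∈ Finset.range a, (f (2 * j) + f (2 * j + 1)) := by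
  induction a with
  | zero => simp
  | succ a ih =>
    rw [show 2 * (a + 1) = 2 * a + 1 + 1 by ring, Finset.sum_range_succ, Finset.sum_range_succ,
      ih, Finset.sum_range_succ]
    ring

lemma FollowsChain.sum_height_mul {n : ℕ} {w : ZMod n → ℤ × ℤ} {u : ZMod n} {ε : ℤ}
    {a : ℕ} {t h : ℕ → ℤ} (F : FollowsChain w u ε a t h) (hε : ε * ε = 1) :
    ∑ r ∈ Finset.range (2 * a), (w (u + (r : ZMod n))).2 *
        ((w (u + (r : ZMod n) + 1)).1 - (w (u + (r : ZMod n))).1) =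
      ∑ j ∈ Finset.range a, h j * (t (j + 1) - t j) := by
  rw [sum_range_two_mul]
  refine Finset.sum_congr rfl fun j hj => ?_
  rw [Finset.mem_range] at hj
  rw [F.even hj.le rfl, F.odd hj rfl,
    F.odd hj (i := u + ((2 * j : ℕ) : ZMod n) + 1) (by push_cast; ring),
    F.even (j := j + 1) hj (i := u + ((2 * j + 1 : ℕ) : ZMod n) + 1) (by push_cast; ring)]
  linear_combination h j * (t (j + 1) - t j) * hε

section Pair

variable {n : ℕ} [NeZero n] {w : ZMod n → ℤ × ℤ} {u : ZMod n} {a b : ℕ} {t h s g : ℕ → ℤ}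

lemma exists_eq_add_natCast (u i : ZMod n) : ∃ r < n, i = u + (r : ZMod n) :=
  ⟨(i - u).val, ZMod.val_lt _, by rw [ZMod.natCast_zmod_val]; ring⟩

lemma FollowsPair.cases (F : FollowsPair w u a b t h s g) (i : ZMod n) :
    (∃ r < 2 * a, i = u + (r : ZMod n)) ∨
      ∃ r < 2 * b, i = u + ((2 * a : ℕ) : ZMod n) + (r : ZMod n) := by
  obtain ⟨r, hr, rfl⟩ := exists_eq_add_natCast u i
  by_cases h1 : r < 2 * a
  · exact Or.inl ⟨r, h1, rfl⟩
  · refine Or.inr ⟨r - 2 * a, by have := F.card; omega, ?_⟩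
    rw [add_assoc, ← Nat.cast_add, Nat.add_sub_cancel' (by omega)]

lemma sum_zmod_eq_sum_range (u : ZMod n) (f : ZMod n → ℤ) :
    ∑ i, f i = ∑ r ∈ Finset.range n, f (u + (r : ZMod n)) := by
  symm
  refine Finset.sum_nbij (fun r : ℕ => u + (r : ZMod n)) (by simp) ?_ ?_ (by simp)
  · intro r hr r' hr' h
    simp only [Finset.coe_range, Set.mem_Iio] at hr hr'
    exact (natCast_inj_of_lt hr hr').1 (add_left_cancel h)
  · intro i _
    obtain ⟨r, hr, rfl⟩ := exists_eq_add_natCast u i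
    exact ⟨r, by simpa using hr, rfl⟩

/-- The shoelace sum of an axis-parallel closed walk. -/
lemma sum_cross_eq (haxis : ∀ i, (w (i + 1)).1 = (w i).1 ∨ (w (i + 1)).2 = (w i).2) :
    ∑ i, cross (w i) (w (i + 1)) = -2 * ∑ i, (w i).2 * ((w (i + 1)).1 - (w i).1) := by
  have h1 : ∑ i, (w (i + 1)).1 * (w (i + 1)).2 = ∑ i, (w i).1 * (w i).2 :=
    Equiv.sum_comp (Equiv.addRight 1) fun i => (w i).1 * (w i).2
  have h2 : ∀ i, cross (w i) (w (i + 1)) = (w (i + 1)).1 * (w (i + 1)).2 - (w i).1 * (w i).2 +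
      -2 * ((w i).2 * ((w (i + 1)).1 - (w i).1)) := by
    intro i
    rw [cross]
    rcases haxis i with h | h <;> rw [h] <;> ring
  rw [Finset.sum_congr rfl fun i _ => h2 i, Finset.sum_add_distrib, Finset.sum_sub_distrib, h1,
    Finset.mul_sum]
  ring

lemma FollowsPair.sum_cross (F : FollowsPair w u a b t h s g)
    (haxis : ∀ i, (w (i + 1)).1 = (w i).1 ∨ (w (i + 1)).2 = (w i).2) :
    ∑ i, cross (w i) (w (i + 1)) = -2 * (∑ j ∈ Finset.range a, h j * (t (j + 1) - t j) +
      ∑ i ∈ Finset.range b, g i * (s (i + 1) - s i)) := by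
  rw [sum_cross_eq haxis, sum_zmod_eq_sum_range u, ← F.left.sum_height_mul (by norm_num),
    ← F.right.sum_height_mul (by norm_num)]
  congr 1
  have := F.card
  conv_lhs => rw [show Finset.range n = Finset.range (2 * a + 2 * b) by rw [this]]
  rw [Finset.sum_range_add]
  congr 1
  refine Finset.sum_congr rfl fun r _ => ?_
  push_cast
  simp only [add_assoc]

end Pair

section Pair

variable {n : ℕ} {w w' : ZMod n → ℤ × ℤ} {u : ZMod n} {a b : ℕ} {t h s g : ℕ → ℤ}

lemma FollowsPair.apply (F : FollowsPair w u a b t h s g) {r : ℕ} (hr : r ≤ n) :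
    w (u + (r : ZMod n)) = walkVertex a t h s g r := by
  by_cases h1 : r < 2 * a
  · rw [F.left r h1.le, F.pair.walkVertex_left h1.le]
    simp
  · obtain ⟨q, rfl⟩ := Nat.exists_eq_add_of_le (not_lt.1 h1)
    rw [Nat.cast_add, ← add_assoc, F.right q (by have := F.card; omega), walkVertex_right]
    ext <;> simp

/-- Every pair of chains with `2 * a + 2 * b` vertices is followed by some closed walk. -/
lemma ChainPair.exists_followsPair [NeZero n] (H : ChainPair a b t h s g)
    (hn : n = 2 * a + 2 * b) (u : ZMod n) :
    ∃ w : ZMod n → ℤ × ℤ, FollowsPair w u a b t h s g := by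
  have key : ∀ r ≤ n, walkVertex a t h s g (u + (r : ZMod n) - u).val =
      walkVertex a t h s g r := by
    intro r hr
    rw [add_sub_cancel_left]
    rcases hr.eq_or_lt with rfl | hr
    · rw [ZMod.natCast_self, ZMod.val_zero]
      conv_rhs => rw [hn]
      exact H.walkVertex_last.symm
    · rw [ZMod.val_natCast_of_lt hr]
  refine ⟨fun i => walkVertex a t h s g (i - u).val, hn, H, fun r hr => ?_, fun r hr => ?_⟩
  · rw [key r (by omega), H.walkVertex_left hr]
    simp
  · rw [add_assoc, ← Nat.cast_add, key _ (by omega), walkVertex_right]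
    ext <;> simp

lemma FollowsPair.simple [NeZero n] (F : FollowsPair w u a b t h s g)
    (S : Separated a b t h s g) (i j : ZMod n) (hij : j ≠ i) (p : ℤ × ℤ)
    (hi : onSeg (w i) (w (i + 1)) p) (hj : onSeg (w j) (w (j + 1)) p) :
    (j = i + 1 ∧ p = w j) ∨ (i = j + 1 ∧ p = w i) := by
  have hn := F.card
  obtain ⟨r, hr, rfl⟩ := exists_eq_add_natCast u i
  obtain ⟨r', hr', rfl⟩ := exists_eq_add_natCast u j
  have hsucc : ∀ k : ℕ, u + (k : ZMod n) + 1 = u + ((k + 1 : ℕ) : ZMod n) := by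
    intro k; push_cast; ring
  have hlast : ∀ k : ℕ, k + 1 = n → u + ((0 : ℕ) : ZMod n) = u + ((k + 1 : ℕ) : ZMod n) := by
    intro k hk; rw [hk]; simp
  rw [hsucc, F.apply hr.le, F.apply hr] at hi
  rw [hsucc, F.apply hr'.le, F.apply hr'] at hj
  rw [hsucc, hsucc, F.apply hr.le, F.apply hr'.le]
  rcases lt_trichotomy r r' with h1 | rfl | h1
  · rcases F.pair.walk_simple S h1 (by omega) hi hj with ⟨rfl, h2⟩ | ⟨rfl, h2, h3⟩
    · exact Or.inl ⟨rfl, h2⟩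
    · exact Or.inr ⟨hlast _ (by omega), h3⟩
  · exact absurd rfl hij
  · rcases F.pair.walk_simple S h1 (by omega) hj hi with ⟨rfl, h2⟩ | ⟨rfl, h2, h3⟩
    · exact Or.inr ⟨rfl, h2⟩
    · exact Or.inl ⟨hlast _ (by omega), h3⟩

/-- Corresponding edges of two closed walks point in the same direction. -/
def SameDirections (w w' : ZMod n → ℤ × ℤ) : Prop :=
  ∀ i, ((w (i + 1)).1 - (w i).1).sign = ((w' (i + 1)).1 - (w' i).1).sign ∧
    ((w (i + 1)).2 - (w i).2).sign = ((w' (i + 1)).2 - (w' i).2).sign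

lemma SameDirections.fst_iff (D : SameDirections w w') (i : ZMod n) :
    (w (i + 1)).1 = (w i).1 ↔ (w' (i + 1)).1 = (w' i).1 := by
  rw [← sub_eq_zero, ← Int.sign_eq_zero_iff_zero, (D i).1, Int.sign_eq_zero_iff_zero, sub_eq_zero]

lemma SameDirections.snd_iff (D : SameDirections w w') (i : ZMod n) :
    (w (i + 1)).2 = (w i).2 ↔ (w' (i + 1)).2 = (w' i).2 := by
  rw [← sub_eq_zero, ← Int.sign_eq_zero_iff_zero, (D i).2, Int.sign_eq_zero_iff_zero, sub_eq_zero]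

lemma RectPolygon.exists_of_sameDirections (P : RectPolygon n) (D : SameDirections P.v w)
    (hsimple : ∀ i j : ZMod n, j ≠ i → ∀ p : ℤ × ℤ, onSeg (w i) (w (i + 1)) p →
      onSeg (w j) (w (j + 1)) p → (j = i + 1 ∧ p = w j) ∨ (i = j + 1 ∧ p = w i)) :
    ∃ P' : RectPolygon n, P'.v = w := by
  refine ⟨⟨w, fun i hi => P.nondeg i ?_, fun i => ?_, fun i => ?_, hsimple⟩, rfl⟩
  · exact Prod.ext ((D.fst_iff i).2 (by rw [hi])) ((D.snd_iff i).2 (by rw [hi]))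
  · rw [← D.fst_iff, ← D.snd_iff]
    exact P.axis i
  · have h1 := P.alt i
    have h2 : i + 2 = i + 1 + 1 := by ring
    rwa [h2, D.fst_iff, D.snd_iff, ← h2] at h1

lemma SameDirections.sign_cross {P P' : RectPolygon n} (D : SameDirections P.v P'.v)
    (i : ZMod n) : (cross (P.dvec (i - 1)) (P.dvec i)).sign =
      (cross (P'.dvec (i - 1)) (P'.dvec i)).sign := by
  have d1 := D (i - 1)
  have d2 := D i
  have z1 := D.fst_iff (i - 1)
  have z2 := D.snd_iff (i - 1)
  have z3 := D.fst_iff i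
  have z4 := D.snd_iff i
  have e2 : i - 1 + 2 = i + 1 := by ring
  have alt := P.alt (i - 1)
  have axis := P.axis (i - 1)
  have axis' := P.axis i
  rw [e2] at alt
  rw [sub_add_cancel] at d1 z1 z2 alt axis
  simp only [cross, RectPolygon.dvec, sub_add_cancel, Prod.fst_sub, Prod.snd_sub]
  by_cases h : (P.v i).1 = (P.v (i - 1)).1
  · have h4 := alt.1 h
    rw [sub_eq_zero.2 h, sub_eq_zero.2 h4, sub_eq_zero.2 (z1.1 h), sub_eq_zero.2 (z4.1 h4)]
    simp only [zero_mul, zero_sub, Int.sign_neg, Int.sign_mul, d1.2, d2.1]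
  · have h2 := axis.resolve_left h
    have h3 := axis'.resolve_right (mt alt.2 h)
    rw [sub_eq_zero.2 h2, sub_eq_zero.2 h3, sub_eq_zero.2 (z2.1 h2), sub_eq_zero.2 (z3.1 h3)]
    simp only [zero_mul, sub_zero, Int.sign_mul, d1.1, d2.2]

lemma SameDirections.convexAt_iff {P P' : RectPolygon n} (D : SameDirections P.v P'.v)
    (i : ZMod n) : P.convexAt i ↔ P'.convexAt i := by
  rw [RectPolygon.convexAt, RectPolygon.convexAt, ← Int.sign_eq_one_iff_pos, D.sign_cross,
    Int.sign_eq_one_iff_pos]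

lemma SameDirections.reflexAt_iff {P P' : RectPolygon n} (D : SameDirections P.v P'.v)
    (i : ZMod n) : P.reflexAt i ↔ P'.reflexAt i := by
  rw [RectPolygon.reflexAt, RectPolygon.reflexAt, ← Int.sign_eq_neg_one_iff_neg, D.sign_cross,
    Int.sign_eq_neg_one_iff_neg]

lemma SameDirections.isXMonotone {P P' : RectPolygon n} (D : SameDirections P.v P'.v)
    (hx : P.IsXMonotone) : P'.IsXMonotone := by
  rw [RectPolygon.IsXMonotone] at hx ⊢
  rw [← hx]
  congr 1
  ext i
  simp only [Set.mem_ofPred_eq, RectPolygon.horiz, RectPolygon.sx]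
  rw [D.snd_iff, ← Int.sign_eq_neg_one_iff_neg, ← Int.sign_eq_neg_one_iff_neg, Int.sign_mul,
    Int.sign_mul, (D i).1, (D (i + 2)).1]

lemma FollowsChain.sameDirections {ε : ℤ} {t' h' : ℕ → ℤ} (F : FollowsChain w u ε a t h)
    (F' : FollowsChain w' u ε a t' h') (ht : ∀ j < a, t j < t (j + 1))
    (ht' : ∀ j < a, t' j < t' (j + 1))
    (hh : ∀ j < a, h j ≠ h (j + 1) ∧ h' j ≠ h' (j + 1) ∧
      (h j < h (j + 1) ↔ h' j < h' (j + 1)))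
    {r : ℕ} (hr : r < 2 * a) {i : ZMod n} (hi : i = u + (r : ZMod n)) :
    ((w (i + 1)).1 - (w i).1).sign = ((w' (i + 1)).1 - (w' i).1).sign ∧
      ((w (i + 1)).2 - (w i).2).sign = ((w' (i + 1)).2 - (w' i).2).sign := by
  obtain ⟨j, rfl | rfl⟩ := Nat.even_or_odd' r
  · have hj : j < a := by omega
    have hi' : i + 1 = u + ((2 * j + 1 : ℕ) : ZMod n) := by rw [hi]; push_cast; ring
    rw [F.even hj.le hi, F'.even hj.le hi, F.odd hj hi', F'.odd hj hi']
    simp only [← mul_sub, Int.sign_mul, sub_self, and_true]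
    rw [Int.sign_eq_one_of_pos (sub_pos.2 (ht j hj)), Int.sign_eq_one_of_pos (sub_pos.2 (ht' j hj))]
  · have hj : j < a := by omega
    have hi' : i + 1 = u + ((2 * (j + 1) : ℕ) : ZMod n) := by rw [hi]; push_cast; ring
    rw [F.odd hj hi, F'.odd hj hi, F.even (j := j + 1) hj hi', F'.even (j := j + 1) hj hi']
    simp only [← mul_sub, Int.sign_mul, sub_self, true_and]
    obtain ⟨h1, h2, h3⟩ := hh j hj
    congr 1
    rcases lt_or_gt_of_ne h1 with h4 | h4
    · rw [Int.sign_eq_one_of_pos (sub_pos.2 h4), Int.sign_eq_one_of_pos (sub_pos.2 (h3.1 h4))]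
    · rw [Int.sign_eq_neg_one_of_neg (sub_neg.2 h4), Int.sign_eq_neg_one_of_neg]
      omega

/-- A polygon of positive area has separated chains. -/
lemma FollowsPair.separated [NeZero n] {P : RectPolygon n} (F : FollowsPair P.v u a b t h s g)
    (hccw : P.ccw) : Separated a b t h s g := by
  have hn := F.card
  refine F.pair.separated (fun r q hr hq p hp hq' => ?_) ?_
  · have hsucc : ∀ k : ℕ, u + (k : ZMod n) + 1 = u + ((k + 1 : ℕ) : ZMod n) := by
      intro k; push_cast; ring
    have := P.simple (u + (r : ZMod n)) (u + ((2 * a + q : ℕ) : ZMod n)) ?_ p ?_ ?_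
    · rw [hsucc, hsucc, add_right_inj, add_right_inj, natCast_inj_of_lt (by omega) (by omega),
        natCast_inj_of_lt (by omega) (by omega)] at this
      omega
    · rw [Ne, add_right_inj, natCast_inj_of_lt (by omega) (by omega)]
      omega
    · rwa [hsucc, F.apply (by omega), F.apply (by omega), F.pair.walkVertex_left (by omega),
        F.pair.walkVertex_left (by omega)]
    · rwa [hsucc, F.apply (by omega), F.apply (by omega), add_assoc, walkVertex_right,
        walkVertex_right, onSeg_neg]
  · rw [RectPolygon.ccw, F.sum_cross P.axis] at hccw
    omega

lemma FollowsPair.ccw [NeZero n] {P : RectPolygon n} (F : FollowsPair P.v u a b t h s g)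
    (S : Separated a b t h s g) : P.ccw := by
  have := F.pair.sum_heights_neg S
  rw [RectPolygon.ccw, F.sum_cross P.axis]
  omega

lemma FollowsPair.convexAt_left {P : RectPolygon n} (F : FollowsPair P.v u a b t h s g)
    (S : Separated a b t h s g) : P.convexAt u := by
  have hb := F.pair.pos_right
  have e : u - 1 = u + ((2 * a : ℕ) : ZMod n) + ((2 * (b - 1) + 1 : ℕ) : ZMod n) := by
    have h1 : ((2 * a + (2 * (b - 1) + 1) + 1 : ℕ) : ZMod n) = 0 := by
      rw [show 2 * a + (2 * (b - 1) + 1) + 1 = n by have := F.card; omega, ZMod.natCast_self]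
    push_cast at h1 ⊢
    linear_combination -h1
  rw [RectPolygon.convexAt, F.right.dvec_odd (by omega) e,
    F.left.dvec_even F.pair.pos_left (i := u) (by simp), cross, Nat.sub_add_cancel hb]
  have h1 := F.pair.mono_left 0 F.pair.pos_left
  have h2 := F.pair.swap.last_lt S.swap
  have h3 : 0 < (g b - g (b - 1)) * (t (0 + 1) - t 0) :=
    mul_pos (sub_pos.2 h2) (sub_pos.2 h1)
  linarith

lemma FollowsPair.convexAt_right {P : RectPolygon n} (F : FollowsPair P.v u a b t h s g)
    (S : Separated a b t h s g) : P.convexAt (u + ((2 * a : ℕ) : ZMod n)) := by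
  have ha := F.pair.pos_left
  have e : u + ((2 * a : ℕ) : ZMod n) - 1 = u + ((2 * (a - 1) + 1 : ℕ) : ZMod n) := by
    obtain ⟨k, rfl⟩ : ∃ k, a = k + 1 := ⟨a - 1, by omega⟩
    simp only [Nat.add_sub_cancel]
    push_cast; ring
  rw [RectPolygon.convexAt, F.left.dvec_odd (by omega) e,
    F.right.dvec_even F.pair.pos_right (by simp), cross, Nat.sub_add_cancel ha]
  have h1 := F.pair.mono_right 0 F.pair.pos_right
  have h2 := F.pair.last_lt S
  have h3 : 0 < (h a - h (a - 1)) * (s (0 + 1) - s 0) :=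
    mul_pos (sub_pos.2 h2) (sub_pos.2 h1)
  linarith

end Pair

section Decomposition

variable {n : ℕ}

lemma RectPolygon.vert_iff_not_horiz (P : RectPolygon n) (i : ZMod n) :
    P.vert i ↔ ¬ P.horiz i := by
  constructor
  · intro h1 h2
    exact P.nondeg i (Prod.ext h1 h2)
  · exact fun h => (P.axis i).resolve_right h

lemma RectPolygon.horiz_add_one (P : RectPolygon n) (i : ZMod n) :
    P.horiz (i + 1) ↔ ¬ P.horiz i := by
  have h := P.alt i
  rw [show i + 2 = i + 1 + 1 by ring] at h
  exact h.symm.trans (P.vert_iff_not_horiz i)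

lemma RectPolygon.horiz_add_natCast (P : RectPolygon n) {u : ZMod n} (hu : P.horiz u) (r : ℕ) :
    P.horiz (u + (r : ZMod n)) ↔ Even r := by
  induction r with
  | zero => simpa using hu
  | succ r ih => rw [Nat.cast_succ, ← add_assoc, P.horiz_add_one, ih, Nat.even_add_one]

lemma RectPolygon.horiz_add_two_mul (P : RectPolygon n) {u : ZMod n} (hu : P.horiz u) (j : ℕ) :
    P.horiz (u + ((2 * j : ℕ) : ZMod n)) :=
  (P.horiz_add_natCast hu _).2 (even_two_mul j)

lemma RectPolygon.vert_add_two_mul (P : RectPolygon n) {u : ZMod n} (hu : P.horiz u) (j : ℕ) :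
    P.vert (u + ((2 * j + 1 : ℕ) : ZMod n)) := by
  rw [P.vert_iff_not_horiz, P.horiz_add_natCast hu]
  simp

lemma RectPolygon.sx_ne_zero (P : RectPolygon n) {i : ZMod n} (hi : P.horiz i) : P.sx i ≠ 0 :=
  fun h => P.nondeg i (Prod.ext (sub_eq_zero.1 h) hi)

lemma RectPolygon.sx_eq (P : RectPolygon n) {u : ZMod n} (hu : P.horiz u) (j : ℕ) :
    P.sx (u + ((2 * j : ℕ) : ZMod n)) =
      (P.v (u + ((2 * (j + 1) : ℕ) : ZMod n))).1 - (P.v (u + ((2 * j : ℕ) : ZMod n))).1 := by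
  have := P.vert_add_two_mul hu j
  rw [RectPolygon.vert, show u + ((2 * j + 1 : ℕ) : ZMod n) + 1 =
    u + ((2 * (j + 1) : ℕ) : ZMod n) by push_cast; ring] at this
  rw [this, RectPolygon.sx]
  congr 3
  push_cast; ring

lemma RectPolygon.followsChain (P : RectPolygon n) {u : ZMod n} (hu : P.horiz u) {ε : ℤ}
    (hε : ε * ε = 1) (a : ℕ) :
    FollowsChain P.v u ε a (fun j => ε * (P.v (u + ((2 * j : ℕ) : ZMod n))).1)
      (fun j => ε * (P.v (u + ((2 * j : ℕ) : ZMod n))).2) := by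
  intro r hr
  obtain ⟨j, rfl | rfl⟩ := Nat.even_or_odd' r
  · rw [chainVertex_even]
    simp only [← mul_assoc, hε, one_mul]
  · rw [chainVertex_odd]
    simp only [← mul_assoc, hε, one_mul]
    have h1 := P.vert_add_two_mul hu j
    have h2 := P.horiz_add_two_mul hu j
    rw [RectPolygon.vert, show u + ((2 * j + 1 : ℕ) : ZMod n) + 1 =
      u + ((2 * (j + 1) : ℕ) : ZMod n) by push_cast; ring] at h1
    rw [RectPolygon.horiz, show u + ((2 * j : ℕ) : ZMod n) + 1 =
      u + ((2 * j + 1 : ℕ) : ZMod n) by push_cast; ring] at h2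
    exact Prod.ext h1.symm h2

lemma RectPolygon.snd_ne (P : RectPolygon n) {u : ZMod n} (hu : P.horiz u) (j : ℕ) :
    (P.v (u + ((2 * j : ℕ) : ZMod n))).2 ≠ (P.v (u + ((2 * (j + 1) : ℕ) : ZMod n))).2 := by
  have h1 := (P.vert_iff_not_horiz _).1 (P.vert_add_two_mul hu j)
  have h2 := P.horiz_add_two_mul hu j
  rw [RectPolygon.horiz, show u + ((2 * j + 1 : ℕ) : ZMod n) + 1 =
    u + ((2 * (j + 1) : ℕ) : ZMod n) by push_cast; ring] at h1
  rw [RectPolygon.horiz, show u + ((2 * j : ℕ) : ZMod n) + 1 =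
    u + ((2 * j + 1 : ℕ) : ZMod n) by push_cast; ring] at h2
  rw [← h2]
  exact fun h => h1 h.symm

/-- The horizontal edges of an x-monotone polygon form one rightward and one leftward run. -/
lemma RectPolygon.exists_runs [NeZero n] (P : RectPolygon n) (hx : P.IsXMonotone) :
    ∃ (u : ZMod n) (a b : ℕ), P.horiz u ∧ n = 2 * a + 2 * b ∧ 0 < a ∧ 0 < b ∧
      (∀ j < a, 0 < P.sx (u + ((2 * j : ℕ) : ZMod n))) ∧
      ∀ j < b, P.sx (u + ((2 * (a + j) : ℕ) : ZMod n)) < 0 := by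
  have hn0 : n ≠ 0 := NeZero.ne n
  rw [RectPolygon.IsXMonotone] at hx
  set S := {i : ZMod n | P.horiz i ∧ P.sx i * P.sx (i + 2) < 0} with hS
  have hmem : ∀ i, i ∈ S ↔ P.horiz i ∧ P.sx i * P.sx (i + 2) < 0 := fun _ => Iff.rfl
  obtain ⟨p, q, hpq, hSpq⟩ := Set.ncard_eq_two.1 hx
  have hp : p ∈ S := by rw [hSpq]; simp
  obtain ⟨N, hN⟩ : ∃ N, n = 2 * N := by
    have := (P.horiz_add_natCast hp.1 n).1 (by simpa using hp.1)
    obtain ⟨N, hN⟩ := this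
    exact ⟨N, by omega⟩
  have hcast : ((2 * N : ℕ) : ZMod n) = 0 := by rw [← hN, ZMod.natCast_self]
  have hstep : ∀ (u : ZMod n) (j : ℕ), u + ((2 * j : ℕ) : ZMod n) + 2 =
      u + ((2 * (j + 1) : ℕ) : ZMod n) := by
    intro u j; push_cast; ring
  obtain ⟨e, he, hsx⟩ : ∃ e ∈ S, P.sx e < 0 := by
    by_cases h1 : P.sx p < 0
    · exact ⟨p, hp, h1⟩
    · have h2 : 0 < P.sx p := by have := P.sx_ne_zero hp.1; omega
      have h3 : P.sx (p + 2) < 0 := (pos_iff_neg_of_mul_neg hp.2).1 h2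
      have hex : ∃ m, 0 < P.sx (p + ((2 * (m + 1) : ℕ) : ZMod n)) :=
        ⟨N - 1, by rw [Nat.sub_add_cancel (by omega), hcast, add_zero]; exact h2⟩
      classical
      have h4 := Nat.find_spec hex
      obtain ⟨m, hm⟩ : ∃ m, Nat.find hex = m + 1 := by
        refine ⟨Nat.find hex - 1, ?_⟩
        have : Nat.find hex ≠ 0 := by
          intro h0
          rw [h0] at h4
          norm_num at h4
          omega
        omega
      have h5 := Nat.find_min hex (m := m) (by omega)
      have h6 := P.horiz_add_two_mul hp.1 (m + 1)
      have h7 := P.sx_ne_zero h6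
      rw [hm] at h4
      have h8 : P.sx (p + ((2 * (m + 1) : ℕ) : ZMod n)) < 0 := by omega
      refine ⟨_, (hmem _).2 ⟨h6, ?_⟩, h8⟩
      rw [hstep]
      exact mul_neg_of_neg_of_pos h8 h4
  have hu : P.horiz (e + 2) := by simpa using P.horiz_add_two_mul he.1 1
  have hu0 : 0 < P.sx (e + 2) := (neg_iff_pos_of_mul_neg he.2).1 hsx
  have hlast : e + 2 + ((2 * (N - 1) : ℕ) : ZMod n) = e := by
    obtain ⟨k, rfl⟩ : ∃ k, N = k + 1 := ⟨N - 1, by omega⟩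
    rw [Nat.add_sub_cancel]
    push_cast at hcast ⊢
    linear_combination hcast
  have hex : ∃ j, P.sx (e + 2 + ((2 * j : ℕ) : ZMod n)) < 0 := ⟨N - 1, by rwa [hlast]⟩
  classical
  obtain ⟨a, ha⟩ : ∃ a, a = Nat.find hex := ⟨_, rfl⟩
  have h1 : P.sx (e + 2 + ((2 * a : ℕ) : ZMod n)) < 0 := by rw [ha]; exact Nat.find_spec hex
  have h2 : ∀ j < a, 0 < P.sx (e + 2 + ((2 * j : ℕ) : ZMod n)) := by
    intro j hj
    have h3 := Nat.find_min hex (m := j) (by omega)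
    have h4 := P.sx_ne_zero (P.horiz_add_two_mul hu j)
    omega
  have haN : a ≤ N - 1 := by rw [ha]; exact Nat.find_min' hex (by rwa [hlast])
  have ha0 : a ≠ 0 := by
    rintro rfl
    simp at h1
    omega
  have hf : e + 2 + ((2 * (a - 1) : ℕ) : ZMod n) ∈ S := by
    refine ⟨P.horiz_add_two_mul hu _, ?_⟩
    rw [hstep, Nat.sub_add_cancel (by omega)]
    exact mul_neg_of_pos_of_neg (h2 _ (by omega)) h1
  have hinj : ∀ j k, j < N → k < N → e + 2 + ((2 * j : ℕ) : ZMod n) =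
      e + 2 + ((2 * k : ℕ) : ZMod n) → j = k := by
    intro j k hj hk hjk
    have := (natCast_inj_of_lt (by omega) (by omega)).1 (add_left_cancel hjk)
    omega
  have hall : ∀ i ∈ S, i = e ∨ i = e + 2 + ((2 * (a - 1) : ℕ) : ZMod n) := by
    intro i hi
    have hne : e ≠ e + 2 + ((2 * (a - 1) : ℕ) : ZMod n) := by
      intro h3
      have h4 : e + 2 + ((2 * (N - 1) : ℕ) : ZMod n) = e + 2 + ((2 * (a - 1) : ℕ) : ZMod n) := by
        rw [hlast]; exact h3
      have := hinj _ _ (by omega) (by omega) h4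
      omega
    rw [hSpq] at hi he hf
    simp only [Set.mem_insert_iff, Set.mem_singleton_iff] at hi he hf
    grind
  refine ⟨e + 2, a, N - a, hu, by omega, by omega, by omega, h2, ?_⟩
  intro j
  induction j with
  | zero => intro; exact h1
  | succ j ih =>
    intro hj
    have h3 := ih (by omega)
    by_contra h4
    have h5 := P.horiz_add_two_mul hu (a + j)
    have h6 := P.sx_ne_zero (P.horiz_add_two_mul hu (a + (j + 1)))
    have h7 : e + 2 + ((2 * (a + j) : ℕ) : ZMod n) ∈ S := by
      refine ⟨h5, ?_⟩
      rw [hstep, add_assoc a j 1]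
      exact mul_neg_of_neg_of_pos h3 (by omega)
    rcases hall _ h7 with h8 | h8
    · have := hinj (a + j) (N - 1) (by omega) (by omega) (h8.trans hlast.symm)
      omega
    · have := hinj _ _ (by omega) (by omega) h8
      omega

lemma RectPolygon.exists_followsPair [NeZero n] (P : RectPolygon n) (hx : P.IsXMonotone) :
    ∃ u a b t h s g, FollowsPair P.v u a b t h s g := by
  obtain ⟨u, a, b, hu, hn, ha, hb, hL, hR⟩ := P.exists_runs hx
  have hu' := P.horiz_add_two_mul hu a
  have hcl : u + ((2 * a : ℕ) : ZMod n) + ((2 * b : ℕ) : ZMod n) = u := by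
    rw [add_assoc, ← Nat.cast_add, ← hn, ZMod.natCast_self, add_zero]
  refine ⟨u, a, b, _, _, _, _, hn, ⟨ha, hb, ?_, ?_, ?_, ?_, ?_, ?_, ?_, ?_⟩,
    P.followsChain hu (by norm_num) a, P.followsChain hu' (by norm_num) b⟩
  · intro j hj
    have := hL j hj
    rw [P.sx_eq hu] at this
    omega
  · intro j hj
    have := hR j hj
    rw [mul_add, Nat.cast_add, ← add_assoc, P.sx_eq hu'] at this
    omega
  · simp
  · simp only [hcl]; simp
  · simp
  · simp only [hcl]; simp
  · intro j _
    simpa using P.snd_ne hu j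
  · intro j _
    simpa using P.snd_ne hu' j

end Decomposition

section BoundingBox

variable {n : ℕ} [NeZero n] (P : RectPolygon n)

lemma RectPolygon.minX_le (i : ZMod n) : P.minX ≤ (P.v i).1 :=
  Finset.inf'_le _ (Finset.mem_univ i)

lemma RectPolygon.le_maxX (i : ZMod n) : (P.v i).1 ≤ P.maxX :=
  Finset.le_sup' (fun i => (P.v i).1) (Finset.mem_univ i)

lemma RectPolygon.minY_le (i : ZMod n) : P.minY ≤ (P.v i).2 :=
  Finset.inf'_le _ (Finset.mem_univ i)

lemma RectPolygon.le_maxY (i : ZMod n) : (P.v i).2 ≤ P.maxY :=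
  Finset.le_sup' (fun i => (P.v i).2) (Finset.mem_univ i)

end BoundingBox

lemma IsValley.of_compat {a : ℕ} {h h' : ℕ → ℤ}
    (hc : ∀ j < a, h j ≠ h (j + 1) ∧ h' j ≠ h' (j + 1) ∧ (h j < h (j + 1) ↔ h' j < h' (j + 1)))
    {j : ℕ} (hj : j < a) (hv : IsValley h' j) : IsValley h j := by
  refine ⟨?_, (hc j hj).2.2.2 hv.2⟩
  rcases j with _ | j
  · exact Or.inl rfl
  · have h1 := hc j (by omega)
    have h2 := hv.1
    simp only [Nat.add_sub_cancel] at h2 ⊢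
    omega

lemma IsPeak.of_compat {a : ℕ} {h h' : ℕ → ℤ}
    (hc : ∀ j < a, h j ≠ h (j + 1) ∧ h' j ≠ h' (j + 1) ∧ (h j < h (j + 1) ↔ h' j < h' (j + 1)))
    {j : ℕ} (hj : j < a) (hp : IsPeak h j) : IsPeak h' j := by
  obtain ⟨h0, h1, h2⟩ := hp
  obtain ⟨j, rfl⟩ : ∃ k, j = k + 1 := ⟨j - 1, by omega⟩
  have h3 := hc j (by omega)
  have h4 := hc (j + 1) hj
  refine ⟨h0, ?_, ?_⟩ <;> simp only [Nat.add_sub_cancel] at * <;> omega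

lemma ChainPair.compat {a b : ℕ} {t h s g t' h' s' g' : ℕ → ℤ} (H : ChainPair a b t h s g)
    (S : Separated a b t h s g) (H' : ChainPair a b t' h' s' g')
    (S' : Separated a b t' h' s' g')
    (hc : ∀ j, j + 1 < a → (h j < h (j + 1) ↔ h' j < h' (j + 1))) :
    ∀ j < a, h j ≠ h (j + 1) ∧ h' j ≠ h' (j + 1) ∧ (h j < h (j + 1) ↔ h' j < h' (j + 1)) := by
  intro j hj
  by_cases hja : j + 1 < a
  · exact ⟨H.ne_left j hja, H'.ne_left j hja, hc j hja⟩
  · obtain rfl : a = j + 1 := by omega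
    have h1 := H.last_lt S
    have h2 := H'.last_lt S'
    simp only [Nat.add_sub_cancel] at h1 h2
    exact ⟨h1.ne, h2.ne, iff_of_true h1 h2⟩

lemma FollowsChain.exists_vertex {n : ℕ} {w : ZMod n → ℤ × ℤ} {u : ZMod n} {ε : ℤ} {a : ℕ}
    {t h : ℕ → ℤ} (F : FollowsChain w u ε a t h) {r : ℕ} (hr : r < 2 * a) :
    ∃ j ≤ a, ∃ k < a, w (u + (r : ZMod n)) = (ε * t j, ε * h k) :=
  ⟨(r + 1) / 2, by omega, r / 2, by omega, F r hr.le⟩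

lemma le_height_of_dominated {a : ℕ} {t h t' h' : ℕ → ℤ} (ht' : ∀ j < a, t' j < t' (j + 1))
    (h0 : t' 0 = t 0) (ha : t' a = t a)
    (hh : ∀ j < a, ∀ i < a, ∀ c, t' j ≤ c → c < t' (j + 1) → t i ≤ c → c < t (i + 1) →
        h' j ≤ h i) {j : ℕ} (hj : j < a) : ∃ i < a, h' j ≤ h i := by
  have h1 := le_of_forall_lt_succ ht' (Nat.zero_le j) hj.le
  have h2 := lt_of_forall_lt_succ ht' hj le_rfl
  obtain ⟨i, hi, h3, h4⟩ := exists_column (t := t) (a := a) (c := t' j) (by omega) (by omega)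
  exact ⟨i, hi, hh j hj i hi _ le_rfl (ht' j hj) h3 h4⟩

/-- Any x-monotone rectilinear polygon can be transformed into a canonical
x-monotone polygon realizing the same angle sequence without increasing the
area of its bounding box. -/
theorem x_monotone_to_canonical_bbox (n : ℕ) [NeZero n] (P : RectPolygon n)
    (hccw : P.ccw) (hx : P.IsXMonotone) :
    ∃ P' : RectPolygon n, P'.ccw ∧ P'.IsXMonotone ∧
      (∀ i : ZMod n, (P.convexAt i ↔ P'.convexAt i) ∧ (P.reflexAt i ↔ P'.reflexAt i)) ∧
      canonicalBox P' ∧ P'.bboxArea ≤ P.bboxArea := by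
  obtain ⟨u, a, b, t, h, s, g, F⟩ := P.exists_followsPair hx
  have S := F.separated hccw
  have H := F.pair
  have hyL : ∀ j < a, P.minY ≤ h j ∧ h j ≤ P.maxY := by
    intro j hj
    have h1 := P.minY_le (u + ((2 * j : ℕ) : ZMod n))
    have h2 := P.le_maxY (u + ((2 * j : ℕ) : ZMod n))
    rw [F.left.even hj.le rfl] at h1 h2
    omega
  have hyR : ∀ j < b, -P.maxY ≤ g j ∧ g j ≤ -P.minY := by
    intro j hj
    have h1 := P.minY_le (u + ((2 * a : ℕ) : ZMod n) + ((2 * j : ℕ) : ZMod n))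
    have h2 := P.le_maxY (u + ((2 * a : ℕ) : ZMod n) + ((2 * j : ℕ) : ZMod n))
    rw [F.right.even hj.le rfl] at h1 h2
    omega
  obtain ⟨t', k, ht0, hta, htm, hkc, hkB, hkv, htl, hks, hkd⟩ :=
    exists_canonical_chain H.mono_left H.ne_left (H.last_lt S) fun j hj => (hyL j hj).1
  obtain ⟨s', l, hs0, hsb, hsm, hlc, hlB, hlv, hsl, hls, hld⟩ :=
    exists_canonical_chain H.mono_right H.ne_right (H.swap.last_lt S.swap)
      fun j hj => (hyR j hj).1
  have Skl := S.of_dominated htm hsm ht0 hta hs0 hsb hkd hld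
  -- extend the heights so that the chains close up
  obtain ⟨h', hh', hha⟩ : ∃ h' : ℕ → ℤ, (∀ j < a, h' j = k j) ∧ h' a = -l 0 :=
    ⟨fun j => if j < a then k j else -l 0, fun j hj => if_pos hj, if_neg (lt_irrefl a)⟩
  obtain ⟨g', hg', hgb⟩ : ∃ g' : ℕ → ℤ, (∀ j < b, g' j = l j) ∧ g' b = -k 0 :=
    ⟨fun j => if j < b then l j else -k 0, fun j hj => if_pos hj, if_neg (lt_irrefl b)⟩
  have S' : Separated a b t' h' s' g' := by
    intro j hj i hi h1 h2
    rw [hh' j hj, hg' i hi]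
    exact Skl j hj i hi h1 h2
  have H' : ChainPair a b t' h' s' g' := by
    refine ⟨H.pos_left, H.pos_right, htm, hsm, by rw [hs0, hta, H.turn],
      by rw [hsb, ht0, H.close], by rw [hha, hg' 0 H.pos_right], by rw [hgb, hh' 0 H.pos_left],
      fun j hj => ?_, fun j hj => ?_⟩
    · rw [hh' _ hj, hh' j (by omega)]; exact (hkc j hj).2
    · rw [hg' _ hj, hg' j (by omega)]; exact (hlc j hj).2
  have cL := H.compat S H' S' fun j hj => by
    rw [hh' _ hj, hh' j (by omega)]; exact (hkc j hj).1
  have cR := H.swap.compat S.swap H'.swap S'.swap fun j hj => by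
    rw [hg' _ hj, hg' j (by omega)]; exact (hlc j hj).1
  obtain ⟨w, Fw⟩ := H'.exists_followsPair F.card u
  have D : SameDirections P.v w := by
    intro i
    rcases F.cases i with ⟨r, hr, hi⟩ | ⟨r, hr, hi⟩
    · exact F.left.sameDirections Fw.left H.mono_left htm cL hr hi
    · exact F.right.sameDirections Fw.right H.mono_right hsm cR hr hi
  obtain ⟨P', rfl⟩ := P.exists_of_sameDirections D (Fw.simple S')
  refine ⟨P', Fw.ccw S', D.isXMonotone hx, fun i => ⟨D.convexAt_iff i, D.reflexAt_iff i⟩, ?_⟩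
  have hturn := H'.turn
  have hclose := H'.close
  have hbox : ∀ i, (t' 0 ≤ (P'.v i).1 ∧ (P'.v i).1 ≤ t' a) ∧
      P.minY ≤ (P'.v i).2 ∧ (P'.v i).2 ≤ P.maxY := by
    intro i
    rcases F.cases i with ⟨r, hr, rfl⟩ | ⟨r, hr, rfl⟩
    · obtain ⟨j, hj, m, hm, e⟩ := Fw.left.exists_vertex hr
      rw [e]
      have h1 := le_of_forall_lt_succ htm (Nat.zero_le j) hj
      have h2 := le_of_forall_lt_succ htm hj le_rfl
      have h3 := hkB m hm
      obtain ⟨q, hq, h4⟩ := le_height_of_dominated htm ht0 hta hkd hm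
      have h5 := hyL q hq
      have h6 := hh' m hm
      simp only [one_mul]
      omega
    · obtain ⟨j, hj, m, hm, e⟩ := Fw.right.exists_vertex hr
      rw [e]
      have h1 := le_of_forall_lt_succ hsm (Nat.zero_le j) hj
      have h2 := le_of_forall_lt_succ hsm hj le_rfl
      have h3 := hlB m hm
      obtain ⟨q, hq, h4⟩ := le_height_of_dominated hsm hs0 hsb hld hm
      have h5 := hyR q hq
      have h6 := hg' m hm
      simp only [neg_mul, one_mul]
      omega
  have hfst0 : (P'.v u).1 = t' 0 := by
    rw [Fw.left.even (j := 0) (Nat.zero_le a) (i := u) (by simp), one_mul]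
  have hfsta : (P'.v (u + ((2 * a : ℕ) : ZMod n))).1 = t' a := by
    rw [Fw.left.even le_rfl rfl, one_mul]
  have hminX : P'.minX = t' 0 :=
    le_antisymm (hfst0 ▸ P'.minX_le u) (Finset.le_inf' _ _ fun i _ => (hbox i).1.1)
  have hmaxX : P'.maxX = t' a :=
    le_antisymm (Finset.sup'_le _ _ fun i _ => (hbox i).1.2) (hfsta ▸ P'.le_maxX _)
  have hminY : P.minY ≤ P'.minY := Finset.le_inf' _ _ fun i _ => (hbox i).2.1
  have hmaxY : P'.maxY ≤ P.maxY := Finset.sup'_le _ _ fun i _ => (hbox i).2.2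
  constructor
  · have cL' : ∀ j < a, h' j ≠ h' (j + 1) ∧ h j ≠ h (j + 1) ∧
        (h' j < h' (j + 1) ↔ h j < h (j + 1)) :=
      fun j hj => ⟨(cL j hj).2.1, (cL j hj).1, (cL j hj).2.2.symm⟩
    have cR' : ∀ j < b, g' j ≠ g' (j + 1) ∧ g j ≠ g (j + 1) ∧
        (g' j < g' (j + 1) ↔ g j < g (j + 1)) :=
      fun j hj => ⟨(cR j hj).2.1, (cR j hj).1, (cR j hj).2.2.symm⟩
    have canL := fun r (hr : r < 2 * a) i (hi : i = u + (r : ZMod n)) =>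
      Fw.left.canonical (by norm_num) htm (Fw.convexAt_left S') (B := P.minY)
        (fun j hj => (cL j hj).2.1)
        (fun j hj hv => by rw [hh' j hj]; exact hkv j hj (hv.of_compat cL hj))
        (fun j hj hv => htl j hj fun hv' => hv (hv'.of_compat cL' hj))
        (fun j hj hp hp' => by
          rw [hh' _ hj, hh' j (by omega)]
          exact hks j hj (fun hq => hp (hq.of_compat cL (by omega)))
            fun hq => hp' (hq.of_compat cL hj))
        hr hi
    have canR := fun r (hr : r < 2 * b) i
        (hi : i = u + ((2 * a : ℕ) : ZMod n) + (r : ZMod n)) =>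
      Fw.right.canonical (by norm_num) hsm (Fw.convexAt_right S') (B := -P.maxY)
        (fun j hj => (cR j hj).2.1)
        (fun j hj hv => by rw [hg' j hj]; exact hlv j hj (hv.of_compat cR hj))
        (fun j hj hv => hsl j hj fun hv' => hv (hv'.of_compat cR' hj))
        (fun j hj hp hp' => by
          rw [hg' _ hj, hg' j (by omega)]
          exact hls j hj (fun hq => hp (hq.of_compat cR (by omega)))
            fun hq => hp' (hq.of_compat cR hj))
        hr hi
    refine ⟨fun i ho => ?_, fun i hv hmin hmax h1 h2 => ?_, fun i hh ho => ?_⟩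
    · have hlo := P'.minY_le i
      have hhi := P'.le_maxY i
      rcases F.cases i with ⟨r, hr, hi⟩ | ⟨r, hr, hi⟩
      · have := (canL r hr i hi).1 ho
        right; omega
      · have := (canR r hr i hi).1 ho
        left; omega
    · rcases F.cases i with ⟨r, hr, hi⟩ | ⟨r, hr, hi⟩
      · exact (canL r hr i hi).2.1 hv (by rwa [one_mul, ← hmaxX]) h1 h2
      · refine (canR r hr i hi).2.1 hv ?_ h1 h2
        rw [hclose, neg_mul_neg, one_mul, ← hminX]
        exact hmin
    · rcases F.cases i with ⟨r, hr, hi⟩ | ⟨r, hr, hi⟩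
      · exact (canL r hr i hi).2.2 hh ho
      · exact (canR r hr i hi).2.2 hh ho
  · have h1 := P.minX_le u
    have h2 := P.le_maxX (u + ((2 * a : ℕ) : ZMod n))
    rw [F.left.even (j := 0) (Nat.zero_le a) (i := u) (by simp), one_mul, ← ht0] at h1
    rw [F.left.even le_rfl rfl, one_mul, ← hta] at h2
    have h3 := lt_of_forall_lt_succ htm H.pos_left le_rfl
    have h4 := (P'.minY_le u).trans (P'.le_maxY u)
    rw [RectPolygon.bboxArea, RectPolygon.bboxArea, RectPolygon.width, RectPolygon.width,
      RectPolygon.height, RectPolygon.height, hminX, hmaxX]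
    simp only at h1 h2
    exact mul_le_mul (by omega) (by omega) (by omega) (by omega)
end

section
/- Any x-monotone rectilinear polygon can be transformed into a perimeter-canonical x-monotone polygon (realizing the same angle sequence) without increasing its perimeter, where perimeter-canonical means: (P1) every vertical edge other than the leftmost and rightmost vertical edges has unit length, and (P2) every horizontal edge of the upper chain T has unit length (assuming r(T) ≥ r(B)). -/
/-- A perimeter-canonical x-monotone polygon: (P1) every vertical edge other than
the leftmost and rightmost vertical edges has unit length, and (P2) every
horizontal edge of the upper chain T (which points leftwards on a ccw walk) has
unit length. -/
def periCanonical {n : ℕ} [NeZero n] (P : RectPolygon n) : Prop :=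
  (∀ i, P.vert i → (P.v i).1 ≠ P.minX → (P.v i).1 ≠ P.maxX → P.elen i = 1) ∧
  (∀ i, P.horiz i → P.sx i < 0 → P.elen i = 1)

namespace RectPolygon

/-- The closed rectilinear walk whose horizontal edges have heights `y k` and
abscissae running from `x k` to `x (k + 1)`. -/
def zigzag (x y : ℕ → ℤ) (m : ℕ) : ℤ × ℤ := (x ((m + 1) / 2), y (m / 2))

/-- The cyclic sequence `x 0, …, x N` increases up to index `a` and decreases afterwards. -/
structure Bimonotone (N a : ℕ) (x : ℕ → ℤ) : Prop where
  pos : 0 < a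
  lt : a < N
  closed : x N = x 0
  up : ∀ k, k < a → x k < x (k + 1)
  down : ∀ k, a ≤ k → k < N → x (k + 1) < x k

/-- Each lower edge lies below each upper edge whose abscissa range it meets. -/
def Separated (N a : ℕ) (x y : ℕ → ℤ) : Prop :=
  ∀ p q, p < a → a ≤ q → q < N → x p ≤ x q → x (q + 1) ≤ x (p + 1) → y p < y q

namespace Bimonotone

variable {N a : ℕ} {x y : ℕ → ℤ}

lemma add_le (h : Bimonotone N a x) {i j : ℕ} (hij : i ≤ j) (hj : j ≤ a) :
    x i + (j - i) ≤ x j := by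
  induction j, hij using Nat.le_induction with
  | base => simp
  | succ j hij ih =>
    have := ih (by omega)
    have := h.up j (by omega)
    push_cast
    omega

lemma le_add (h : Bimonotone N a x) {i j : ℕ} (hi : a ≤ i) (hij : i ≤ j) (hj : j ≤ N) :
    x j + (j - i) ≤ x i := by
  induction j, hij using Nat.le_induction with
  | base => simp
  | succ j hij ih =>
    have := ih (by omega)
    have := h.down j (by omega) (by omega)
    push_cast
    omega

lemma bounds (h : Bimonotone N a x) {k : ℕ} (hk : k ≤ N) : x 0 ≤ x k ∧ x k ≤ x a := by
  have hN := h.closed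
  have := h.lt
  rcases le_total k a with hka | hka
  · have h1 := h.add_le (Nat.zero_le k) hka
    have h2 := h.add_le hka le_rfl
    push_cast at *
    omega
  · have h1 := h.le_add hka hk le_rfl
    have h2 := h.le_add le_rfl hka hk
    omega

lemma separated_or (h : Bimonotone N a x)
    (hne : ∀ p q, p < a → a ≤ q → q < N → x p ≤ x q → x (q + 1) ≤ x (p + 1) → y p ≠ y q)
    (hlow : ∀ p q, p + 1 < a → a ≤ q → q < N → x (q + 1) ≤ x (p + 1) → x (p + 1) ≤ x q →
      (y p < y q ↔ y (p + 1) < y q))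
    (hupp : ∀ p q, p < a → a ≤ q → q + 1 < N → x p ≤ x (q + 1) → x (q + 1) ≤ x (p + 1) →
      (y p < y q ↔ y p < y (q + 1))) :
    Separated N a x y ∨ Separated N a x (fun k => -y k) := by
  have key : ∀ s p q, p + (N - 1 - q) = s → p < a → a ≤ q → q < N → x p ≤ x q →
      x (q + 1) ≤ x (p + 1) → (y p < y q ↔ y 0 < y (N - 1)) := by
    intro s
    induction s with
    | zero =>
      intro p q hs hp hq hqN _ _
      obtain rfl : p = 0 := by omega
      obtain rfl : q = N - 1 := by omega
      rfl
    | succ s ih =>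
      intro p q hs hp hq hqN h1 h2
      by_cases hlt : x (q + 1) < x p
      · have hp0 : p ≠ 0 := by
          rintro rfl
          have := (h.bounds (k := q + 1) (by omega)).1
          omega
        obtain ⟨p, rfl⟩ := Nat.exists_eq_add_one_of_ne_zero hp0
        have h3 := h.up p (by omega)
        rw [← hlow p q (by omega) hq hqN hlt.le h1]
        exact ih p q (by omega) (by omega) hq hqN (by omega) (by omega)
      · have hqN' : q + 1 < N := by
          by_contra hc
          obtain rfl : N = q + 1 := by omega
          rw [h.closed] at hlt
          have := h.add_le (Nat.zero_le p) hp.le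
          push_cast at this
          omega
        have h3 := h.down (q + 1) (by omega) hqN'
        rw [hupp p q hp hq hqN' (by omega) h2]
        exact ih p (q + 1) (by omega) hp (by omega) hqN' (by omega) (by omega)
  by_cases h0 : y 0 < y (N - 1)
  · exact Or.inl fun p q hp hq hqN h1 h2 => (key _ p q rfl hp hq hqN h1 h2).2 h0
  · refine Or.inr fun p q hp hq hqN h1 h2 => ?_
    have h3 := hne p q hp hq hqN h1 h2
    have h4 := key _ p q rfl hp hq hqN h1 h2
    simp only [neg_lt_neg_iff]
    omega

end Bimonotone

lemma exists_sum_Ico_eq (X Y : ℕ → ℤ) (m : ℕ) (hX : ∀ k, k < m → X k < X (k + 1)) :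
    X 0 ≤ X m ∧ ∃ F : ℤ → ℤ,
      ∑ k ∈ Finset.range m, Y k * (X (k + 1) - X k) = ∑ z ∈ Finset.Ico (X 0) (X m), F z ∧
      ∀ z ∈ Finset.Ico (X 0) (X m), ∃ p < m, X p ≤ z ∧ z < X (p + 1) ∧ F z = Y p := by
  induction m with
  | zero => exact ⟨le_rfl, 0, by simp⟩
  | succ m ih =>
    obtain ⟨hle, F, hsum, hF⟩ := ih fun k hk => hX k (by omega)
    have hm := hX m (by omega)
    refine ⟨by omega, fun z => if z < X m then F z else Y m, ?_, ?_⟩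
    · rw [Finset.sum_range_succ, hsum,
        ← Finset.Ico_union_Ico_eq_Ico hle hm.le,
        Finset.sum_union (Finset.Ico_disjoint_Ico_consecutive _ _ _)]
      congr 1
      · refine Finset.sum_congr rfl fun z hz => ?_
        rw [if_pos (Finset.mem_Ico.1 hz).2]
      · rw [Finset.sum_congr rfl (g := fun _ => Y m)]
        · rw [Finset.sum_const, Int.card_Ico, nsmul_eq_mul, Int.toNat_of_nonneg (by omega)]
          ring
        · intro z hz
          rw [if_neg (by have := (Finset.mem_Ico.1 hz).1; omega)]
    · intro z hz
      rw [Finset.mem_Ico] at hz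
      by_cases hzm : z < X m
      · obtain ⟨p, hp, h1, h2, h3⟩ := hF z (Finset.mem_Ico.2 ⟨hz.1, hzm⟩)
        exact ⟨p, by omega, h1, h2, by simp [hzm, h3]⟩
      · exact ⟨m, by omega, by omega, hz.2, by simp [hzm]⟩

lemma Bimonotone.area_pos {N a : ℕ} {x y : ℕ → ℤ} (h : Bimonotone N a x)
    (hs : Separated N a x y) : 0 < ∑ k ∈ Finset.range N, y k * (x k - x (k + 1)) := by
  have hlt := h.lt
  obtain ⟨-, F, hF, hF'⟩ := exists_sum_Ico_eq x y a h.up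
  obtain ⟨-, G, hG, hG'⟩ := exists_sum_Ico_eq (fun j => x (N - j)) (fun j => y (N - 1 - j))
    (N - a) (fun k hk => by
      have := h.down (N - (k + 1)) (by omega) (by omega)
      rwa [show N - (k + 1) + 1 = N - k by omega] at this)
  have ha : N - (N - a) = a := by omega
  simp only [Nat.sub_zero, h.closed, ha] at hG hG'
  have htop : ∑ k ∈ Finset.range (N - a), y (N - 1 - k) * (x (N - (k + 1)) - x (N - k)) =
      ∑ k ∈ Finset.range (N - a), y (a + k) * (x (a + k) - x (a + k + 1)) := by
    rw [← Finset.sum_range_reflect]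
    refine Finset.sum_congr rfl fun k hk => ?_
    rw [Finset.mem_range] at hk
    rw [show N - 1 - (N - a - 1 - k) = a + k by omega,
      show N - (N - a - 1 - k + 1) = a + k by omega,
      show N - (N - a - 1 - k) = a + k + 1 by omega]
  have hsplit : ∑ k ∈ Finset.range N, y k * (x k - x (k + 1)) =
      ∑ z ∈ Finset.Ico (x 0) (x a), (G z - F z) := by
    rw [Finset.sum_sub_distrib, ← hG, ← hF, htop]
    conv_lhs => rw [show N = a + (N - a) by omega, Finset.sum_range_add]
    rw [add_comm, sub_eq_add_neg, ← Finset.sum_neg_distrib]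
    congr 1
    exact Finset.sum_congr rfl fun k _ => by ring
  rw [hsplit]
  refine Finset.sum_pos (fun z hz => ?_) ?_
  · obtain ⟨p, hp, hp1, hp2, hp3⟩ := hF' z hz
    obtain ⟨j, hj, hj1, hj2, hj3⟩ := hG' z hz
    rw [hp3, hj3]
    have := hs p (N - 1 - j) hp (by omega) (by omega)
      (by rw [show N - 1 - j = N - (j + 1) by omega]; omega)
      (by rw [show N - 1 - j + 1 = N - j by omega]; omega)
    omega
  · have := h.add_le (Nat.zero_le a) le_rfl
    have := h.pos
    push_cast at *
    exact ⟨x 0, Finset.mem_Ico.2 ⟨le_rfl, by omega⟩⟩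

section zigzag

variable (x y : ℕ → ℤ) (k : ℕ)

lemma zigzag_even : zigzag x y (2 * k) = (x k, y k) := by
  simp only [zigzag]
  rw [show (2 * k + 1) / 2 = k by omega, show 2 * k / 2 = k by omega]

lemma zigzag_odd : zigzag x y (2 * k + 1) = (x (k + 1), y k) := by
  simp only [zigzag]
  rw [show (2 * k + 1 + 1) / 2 = k + 1 by omega, show (2 * k + 1) / 2 = k by omega]

variable {x y k} {p : ℤ × ℤ}

lemma onSeg_zigzag_even :
    onSeg (zigzag x y (2 * k)) (zigzag x y (2 * k + 1)) p ↔
      min (x k) (x (k + 1)) ≤ p.1 ∧ p.1 ≤ max (x k) (x (k + 1)) ∧ p.2 = y k := by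
  simp only [onSeg, zigzag_even, zigzag_odd, min_self, max_self]
  omega

lemma onSeg_zigzag_odd :
    onSeg (zigzag x y (2 * k + 1)) (zigzag x y (2 * k + 1 + 1)) p ↔
      p.1 = x (k + 1) ∧ min (y k) (y (k + 1)) ≤ p.2 ∧ p.2 ≤ max (y k) (y (k + 1)) := by
  rw [show 2 * k + 1 + 1 = 2 * (k + 1) by ring]
  simp only [onSeg, zigzag_even, zigzag_odd, min_self, max_self]
  omega

end zigzag

section simple

variable {N a : ℕ} {x y : ℕ → ℤ} {p : ℤ × ℤ}

lemma Separated.horizontal_horizontal (hs : Separated N a x y) (h : Bimonotone N a x)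
    (hy : ∀ k, k < N → y (k + 1) ≠ y k) {k l : ℕ} (hkl : k < l) (hl : l < N)
    (h1 : onSeg (zigzag x y (2 * k)) (zigzag x y (2 * k + 1)) p)
    (h2 : onSeg (zigzag x y (2 * l)) (zigzag x y (2 * l + 1)) p) : False := by
  rw [onSeg_zigzag_even] at h1 h2
  rcases lt_or_ge l a with hla | hla
  · have := h.add_le (i := k + 1) (j := l) hkl hla.le
    have := h.up k (by omega)
    have := h.up l hla
    obtain rfl : l = k + 1 := by push_cast at *; omega
    exact hy k (by omega) (by omega)
  · have := h.down l hla hl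
    rcases lt_or_ge k a with hka | hka
    · have := h.up k hka
      have := hs k l hka hla hl (by omega) (by omega)
      omega
    · have := h.le_add (i := k + 1) (j := l) (by omega) hkl hl.le
      have := h.down k hka (by omega)
      obtain rfl : l = k + 1 := by push_cast at *; omega
      exact hy k (by omega) (by omega)

lemma Separated.horizontal_vertical (hs : Separated N a x y) (h : Bimonotone N a x)
    {k l : ℕ} (hk : k < N) (hl : l < N)
    (h1 : onSeg (zigzag x y (2 * k)) (zigzag x y (2 * k + 1)) p)
    (h2 : onSeg (zigzag x y (2 * l + 1)) (zigzag x y (2 * l + 1 + 1)) p) :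
    (l = k ∧ p = (x (k + 1), y k)) ∨ (l + 1 = k ∧ p = (x k, y k)) ∨
      (k = 0 ∧ l + 1 = N ∧ p = (x 0, y 0)) := by
  rw [onSeg_zigzag_even] at h1
  rw [onSeg_zigzag_odd] at h2
  have hp : p = (x (l + 1), y k) := Prod.ext h2.1 h1.2.2
  have hc := h.closed
  rcases lt_or_ge k a with hka | hka
  · have hkx := h.up k hka
    rcases le_or_gt (l + 1) a with hla | hla
    · rcases lt_trichotomy (l + 1) k with hlt | rfl | hlt
      · have := h.add_le hlt.le hka.le
        push_cast at *
        omega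
      · exact Or.inr (Or.inl ⟨rfl, hp⟩)
      · rcases eq_or_ne l k with rfl | hne
        · exact Or.inl ⟨rfl, hp⟩
        · have := h.add_le (i := k + 1) (j := l + 1) (by omega) hla
          push_cast at *
          omega
    · have hlx := h.down l (by omega) hl
      rcases eq_or_ne (l + 1) N with hlN | hlN
      · rw [hlN, hc] at h2
        have := h.add_le (Nat.zero_le k) hka.le
        obtain rfl : k = 0 := by push_cast at *; omega
        exact Or.inr (Or.inr ⟨rfl, hlN, by rw [hp, hlN, hc]⟩)
      · have hlx' := h.down (l + 1) (by omega) (by omega)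
        have := hs k l hka (by omega) hl (by omega) (by omega)
        have := hs k (l + 1) hka (by omega) (by omega) (by omega) (by omega)
        omega
  · have hkx := h.down k hka hk
    rcases le_or_gt a (l + 1) with hla | hla
    · rcases lt_trichotomy (l + 1) k with hlt | rfl | hlt
      · have := h.le_add hla hlt.le hk.le
        push_cast at *
        omega
      · exact Or.inr (Or.inl ⟨rfl, hp⟩)
      · rcases eq_or_ne l k with rfl | hne
        · exact Or.inl ⟨rfl, hp⟩
        · have := h.le_add (i := k + 1) (j := l + 1) (by omega) (by omega) (by omega)
          push_cast at *
          omega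
    · have hlx := h.up l (by omega)
      have hlx' := h.up (l + 1) (by omega)
      have := hs l k (by omega) hka hk (by omega) (by omega)
      have := hs (l + 1) k (by omega) hka hk (by omega) (by omega)
      omega

lemma Separated.vertical_vertical (hs : Separated N a x y) (h : Bimonotone N a x)
    {k l : ℕ} (hkl : k < l) (hl : l < N)
    (h1 : onSeg (zigzag x y (2 * k + 1)) (zigzag x y (2 * k + 1 + 1)) p)
    (h2 : onSeg (zigzag x y (2 * l + 1)) (zigzag x y (2 * l + 1 + 1)) p) : False := by
  rw [onSeg_zigzag_odd] at h1 h2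
  have hc := h.closed
  rcases le_or_gt (l + 1) a with hla | hla
  · have := h.add_le (i := k + 1) (j := l + 1) (by omega) hla
    push_cast at *
    omega
  · rcases le_or_gt a (k + 1) with hka | hka
    · have := h.le_add (i := k + 1) (j := l + 1) hka (by omega) (by omega)
      push_cast at *
      omega
    · rcases eq_or_ne (l + 1) N with hlN | hlN
      · rw [hlN, hc] at h2
        have := h.add_le (Nat.zero_le (k + 1)) hka.le
        push_cast at *
        omega
      · have hk := h.up k (by omega)
        have hk' := h.up (k + 1) hka
        have hlx := h.down l (by omega) hl
        have hlx' := h.down (l + 1) (by omega) (by omega)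
        have := hs k l (by omega) (by omega) hl (by omega) (by omega)
        have := hs k (l + 1) (by omega) (by omega) (by omega) (by omega) (by omega)
        have := hs (k + 1) l (by omega) (by omega) hl (by omega) (by omega)
        have := hs (k + 1) (l + 1) (by omega) (by omega) (by omega) (by omega) (by omega)
        omega

lemma Separated.zigzag_simple (hs : Separated N a x y) (h : Bimonotone N a x)
    (hy : ∀ k, k < N → y (k + 1) ≠ y k) {i j : ℕ} (hij : i < j) (hj : j < 2 * N)
    (h1 : onSeg (zigzag x y i) (zigzag x y (i + 1)) p)
    (h2 : onSeg (zigzag x y j) (zigzag x y (j + 1)) p) :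
    (j = i + 1 ∧ p = zigzag x y j) ∨ (i = 0 ∧ j + 1 = 2 * N ∧ p = zigzag x y i) := by
  obtain ⟨k, rfl | rfl⟩ := i.even_or_odd'
  · obtain ⟨l, rfl | rfl⟩ := j.even_or_odd'
    · exact (hs.horizontal_horizontal h hy (by omega) (by omega) h1 h2).elim
    · rcases hs.horizontal_vertical h (by omega) (by omega) h1 h2 with
        ⟨rfl, hp⟩ | ⟨hlk, hp⟩ | ⟨rfl, hl, hp⟩
      · exact Or.inl ⟨rfl, by rw [hp, zigzag_odd]⟩
      · omega
      · exact Or.inr ⟨rfl, by omega, by rw [hp, zigzag_even]⟩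
  · obtain ⟨l, rfl | rfl⟩ := j.even_or_odd'
    · rcases hs.horizontal_vertical h (by omega) (by omega) h2 h1 with
        ⟨rfl, hp⟩ | ⟨rfl, hp⟩ | ⟨rfl, hl, hp⟩
      · omega
      · exact Or.inl ⟨by omega, by rw [hp, zigzag_even]⟩
      · omega
    · exact (hs.vertical_vertical h (by omega) (by omega) h1 h2).elim

end simple

section traced

variable {n N a : ℕ} {x y : ℕ → ℤ}

lemma val_add_one_sub [NeZero n] (i i₀ : ZMod n) :
    (i + 1 - i₀).val = if (i - i₀).val + 1 = n then 0 else (i - i₀).val + 1 := by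
  have hlt := ZMod.val_lt (i - i₀)
  rw [show i + 1 - i₀ = i - i₀ + 1 by ring, ZMod.val_add, ZMod.val_one_eq_one_mod,
    Nat.add_mod_mod]
  split_ifs with h
  · rw [h, Nat.mod_self]
  · exact Nat.mod_eq_of_lt (by omega)

lemma zigzag_val_add_one [NeZero n] (hn : n = 2 * N) (hx : x N = x 0) (hy : y N = y 0)
    (i i₀ : ZMod n) : zigzag x y (i + 1 - i₀).val = zigzag x y ((i - i₀).val + 1) := by
  rw [val_add_one_sub]
  split_ifs with h
  · rw [h, hn, zigzag_even, hx, hy]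
    rfl
  · rfl

lemma zigzag_fst_eq_iff (hx : ∀ k, k < N → x (k + 1) ≠ x k) {m : ℕ} (hm : m < 2 * N) :
    (zigzag x y (m + 1)).1 = (zigzag x y m).1 ↔ m % 2 = 1 := by
  obtain ⟨k, rfl | rfl⟩ := m.even_or_odd'
  · simpa [zigzag_even, zigzag_odd] using hx k (by omega)
  · rw [show 2 * k + 1 + 1 = 2 * (k + 1) by ring]
    simp only [zigzag_even, zigzag_odd, true_iff]
    omega

lemma zigzag_snd_eq_iff (hy : ∀ k, k < N → y (k + 1) ≠ y k) {m : ℕ} (hm : m < 2 * N) :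
    (zigzag x y (m + 1)).2 = (zigzag x y m).2 ↔ m % 2 = 0 := by
  obtain ⟨k, rfl | rfl⟩ := m.even_or_odd'
  · simp only [zigzag_even, zigzag_odd, true_iff]
    omega
  · rw [show 2 * k + 1 + 1 = 2 * (k + 1) by ring]
    have := hy k (by omega)
    simp only [zigzag_even, zigzag_odd]
    omega

lemma Bimonotone.ne (h : Bimonotone N a x) (k : ℕ) (hk : k < N) : x (k + 1) ≠ x k := by
  rcases lt_or_ge k a with hka | hka
  · exact (h.up k hka).ne'
  · exact (h.down k hka hk).ne

lemma eq_add_natCast_val [NeZero n] (i i₀ : ZMod n) : i = i₀ + ((i - i₀).val : ZMod n) := by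
  rw [ZMod.natCast_zmod_val]
  ring

lemma exists_eq_zigzag [NeZero n] (hn : n = 2 * N) (i₀ : ZMod n) (h : Bimonotone N a x)
    (hs : Separated N a x y) (hyN : y N = y 0) (hy : ∀ k, k < N → y (k + 1) ≠ y k) :
    ∃ P : RectPolygon n, ∀ i, P.v i = zigzag x y (i - i₀).val := by
  have hlt (i : ZMod n) : (i - i₀).val < 2 * N := hn ▸ ZMod.val_lt (i - i₀)
  have hstep (i : ZMod n) : zigzag x y (i + 1 - i₀).val = zigzag x y ((i - i₀).val + 1) :=
    zigzag_val_add_one hn h.closed hyN i i₀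
  have hfst (i : ZMod n) := zigzag_fst_eq_iff (y := y) h.ne (hlt i)
  have hsnd (i : ZMod n) := zigzag_snd_eq_iff (x := x) hy (hlt i)
  have hadj (i j : ZMod n) (hij : (i - i₀).val < (j - i₀).val) (p : ℤ × ℤ)
      (h1 : onSeg (zigzag x y (i - i₀).val) (zigzag x y (i + 1 - i₀).val) p)
      (h2 : onSeg (zigzag x y (j - i₀).val) (zigzag x y (j + 1 - i₀).val) p) :
      (j = i + 1 ∧ p = zigzag x y (j - i₀).val) ∨
        (i = j + 1 ∧ p = zigzag x y (i - i₀).val) := by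
    rw [hstep] at h1 h2
    rcases hs.zigzag_simple h hy hij (hlt j) h1 h2 with ⟨hj, hp⟩ | ⟨hi, hj, hp⟩
    · refine Or.inl ⟨?_, hp⟩
      rw [eq_add_natCast_val j i₀, eq_add_natCast_val i i₀, hj]
      push_cast
      ring
    · refine Or.inr ⟨?_, hp⟩
      have hj' : (((j - i₀).val + 1 : ℕ) : ZMod n) = 0 := by rw [hj, ← hn, ZMod.natCast_self]
      rw [eq_add_natCast_val j i₀, eq_add_natCast_val i i₀, hi, add_assoc]
      push_cast at hj' ⊢
      rw [hj']
  refine ⟨⟨fun i => zigzag x y (i - i₀).val, fun i hi => ?_, fun i => ?_, fun i => ?_,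
    fun i j hji p h1 h2 => ?_⟩, fun i => rfl⟩
  · rw [hstep] at hi
    have h1 := (hfst i).1 (by rw [hi])
    have h2 := (hsnd i).1 (by rw [hi])
    omega
  · rw [hstep, hfst, hsnd]
    omega
  · rw [show i + 2 = i + 1 + 1 by ring, hstep i, hfst, ← hstep i, hstep (i + 1), hsnd, val_add_one_sub]
    split_ifs <;> omega
  · rcases lt_trichotomy (i - i₀).val (j - i₀).val with hij | hij | hij
    · exact hadj i j hij p h1 h2
    · exact absurd (sub_left_injective (ZMod.val_injective n hij)).symm hji
    · exact (hadj j i hij p h2 h1).symm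

end traced

section basic

variable {n : ℕ} (P : RectPolygon n) (i : ZMod n)

lemma horiz_iff_sy : P.horiz i ↔ P.sy i = 0 := by simp [horiz, sy, sub_eq_zero]

lemma vert_iff_sx : P.vert i ↔ P.sx i = 0 := by simp [vert, sx, sub_eq_zero]

lemma horiz_iff_not_vert : P.horiz i ↔ ¬ P.vert i := by
  refine ⟨fun hh hv => P.nondeg i (Prod.ext hv hh), (P.axis i).resolve_left⟩

lemma vert_iff_horiz_add_one : P.vert i ↔ P.horiz (i + 1) := by
  have := P.alt i
  rwa [show i + 2 = i + 1 + 1 by ring] at this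

lemma horiz_iff_vert_add_one : P.horiz i ↔ P.vert (i + 1) := by
  rw [horiz_iff_not_vert, vert_iff_horiz_add_one, horiz_iff_not_vert, not_not]

lemma cross_dvec :
    cross (P.dvec (i - 1)) (P.dvec i) = P.sx (i - 1) * P.sy i - P.sy (i - 1) * P.sx i := by
  simp [cross, dvec, sx, sy]

lemma sign_cross_dvec :
    (cross (P.dvec (i - 1)) (P.dvec i)).sign =
      (P.sx (i - 1)).sign * (P.sy i).sign - (P.sy (i - 1)).sign * (P.sx i).sign := by
  have h := P.horiz_iff_vert_add_one (i - 1)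
  have h' := P.horiz_iff_not_vert (i - 1)
  rw [sub_add_cancel, horiz_iff_sy, vert_iff_sx] at h
  rw [horiz_iff_sy, vert_iff_sx] at h'
  rw [cross_dvec]
  by_cases h0 : P.sy (i - 1) = 0
  · simp [h0, h.1 h0, Int.sign_mul]
  · have : P.sx (i - 1) = 0 := by tauto
    simp [this, Int.sign_mul]

end basic

section transfer

variable {n : ℕ} {P Q : RectPolygon n} (hx : ∀ i, (P.sx i).sign = (Q.sx i).sign)
  (hy : ∀ i, (P.sy i).sign = (Q.sy i).sign)
include hx hy

lemma turn_congr (i : ZMod n) :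
    (P.convexAt i ↔ Q.convexAt i) ∧ (P.reflexAt i ↔ Q.reflexAt i) := by
  have hc : (cross (P.dvec (i - 1)) (P.dvec i)).sign =
      (cross (Q.dvec (i - 1)) (Q.dvec i)).sign := by
    simp only [sign_cross_dvec, hx, hy]
  constructor
  · rw [convexAt, convexAt, ← Int.sign_pos_iff, hc, Int.sign_pos_iff]
  · rw [reflexAt, reflexAt, ← Int.sign_neg_iff, hc, Int.sign_neg_iff]

lemma isXMonotone_congr : P.IsXMonotone ↔ Q.IsXMonotone := by
  have key (i : ZMod n) : (P.horiz i ∧ P.sx i * P.sx (i + 2) < 0) ↔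
      (Q.horiz i ∧ Q.sx i * Q.sx (i + 2) < 0) := by
    rw [horiz_iff_sy, horiz_iff_sy, ← Int.sign_eq_zero_iff_zero, hy, Int.sign_eq_zero_iff_zero,
      ← Int.sign_neg_iff, Int.sign_mul, hx, hx, ← Int.sign_mul, Int.sign_neg_iff]
  simp only [IsXMonotone, key]

end transfer

section sums

lemma sum_range_two_mul (f : ℕ → ℤ) (N : ℕ) :
    ∑ m ∈ Finset.range (2 * N), f m = ∑ k ∈ Finset.range N, (f (2 * k) + f (2 * k + 1)) := by
  induction N with
  | zero => simp
  | succ N ih =>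
    rw [show 2 * (N + 1) = 2 * N + 1 + 1 by ring, Finset.sum_range_succ, Finset.sum_range_succ, ih,
      Finset.sum_range_succ]
    ring

lemma sum_zmod_val_sub {n : ℕ} [NeZero n] (f : ℕ → ℤ) (i₀ : ZMod n) :
    ∑ i : ZMod n, f (i - i₀).val = ∑ m ∈ Finset.range n, f m := by
  rw [Fintype.sum_equiv (Equiv.subRight i₀) (fun i => f (i - i₀).val) (fun i => f i.val)
    (fun i => rfl)]
  obtain ⟨m, rfl⟩ := Nat.exists_eq_add_one_of_ne_zero (NeZero.ne n)
  exact (Finset.sum_range f).symm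

variable {n N : ℕ} {x y : ℕ → ℤ} {P : RectPolygon n} {i₀ : ZMod n}
  (hn : n = 2 * N) (hx : x N = x 0) (hy : y N = y 0)
  (hP : ∀ i, P.v i = zigzag x y (i - i₀).val)
include hn hx hy hP

lemma v_natCast_eq {m : ℕ} (hm : m ≤ 2 * N) : P.v (i₀ + m) = zigzag x y m := by
  rcases hm.lt_or_eq with hlt | rfl
  · rw [hP, add_sub_cancel_left, ZMod.val_natCast_of_lt (by omega)]
  · rw [hP, add_sub_cancel_left, ← hn, ZMod.natCast_self, ZMod.val_zero, hn, zigzag_even, hx, hy]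
    rfl

lemma v_natCast_add_one_eq {m : ℕ} (hm : m < 2 * N) :
    P.v (i₀ + m + 1) = zigzag x y (m + 1) := by
  rw [← v_natCast_eq hn hx hy hP (show m + 1 ≤ 2 * N from hm)]
  push_cast
  rw [add_assoc]

lemma sx_even {k : ℕ} (hk : k < N) : P.sx (i₀ + (2 * k : ℕ)) = x (k + 1) - x k := by
  rw [sx, v_natCast_eq hn hx hy hP (by omega), v_natCast_add_one_eq hn hx hy hP (by omega),
    zigzag_even, zigzag_odd]

lemma sy_even {k : ℕ} (hk : k < N) : P.sy (i₀ + (2 * k : ℕ)) = 0 := by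
  rw [sy, v_natCast_eq hn hx hy hP (by omega), v_natCast_add_one_eq hn hx hy hP (by omega),
    zigzag_even, zigzag_odd, sub_self]

lemma sx_odd {k : ℕ} (hk : k < N) : P.sx (i₀ + (2 * k + 1 : ℕ)) = 0 := by
  rw [sx, v_natCast_eq hn hx hy hP (by omega), v_natCast_add_one_eq hn hx hy hP (by omega),
    show 2 * k + 1 + 1 = 2 * (k + 1) by ring, zigzag_even, zigzag_odd, sub_self]

lemma sy_odd {k : ℕ} (hk : k < N) : P.sy (i₀ + (2 * k + 1 : ℕ)) = y (k + 1) - y k := by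
  rw [sy, v_natCast_eq hn hx hy hP (by omega), v_natCast_add_one_eq hn hx hy hP (by omega),
    show 2 * k + 1 + 1 = 2 * (k + 1) by ring, zigzag_even, zigzag_odd]

lemma cross_odd {k : ℕ} (hk : k < N) :
    cross (P.dvec (i₀ + (2 * k + 1 : ℕ) - 1)) (P.dvec (i₀ + (2 * k + 1 : ℕ))) =
      (x (k + 1) - x k) * (y (k + 1) - y k) := by
  have hi : i₀ + (2 * k + 1 : ℕ) - 1 = i₀ + (2 * k : ℕ) := by push_cast; ring
  rw [cross_dvec, hi, sx_even hn hx hy hP hk, sy_odd hn hx hy hP hk, sx_odd hn hx hy hP hk,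
    mul_zero, sub_zero]

lemma cross_even {k : ℕ} (hk : k + 1 < N) :
    cross (P.dvec (i₀ + (2 * (k + 1) : ℕ) - 1)) (P.dvec (i₀ + (2 * (k + 1) : ℕ))) =
      -((y (k + 1) - y k) * (x (k + 2) - x (k + 1))) := by
  have hi : i₀ + (2 * (k + 1) : ℕ) - 1 = i₀ + (2 * k + 1 : ℕ) := by push_cast; ring
  rw [cross_dvec, hi, sx_even hn hx hy hP hk, sy_even hn hx hy hP hk,
    sy_odd hn hx hy hP (by omega), mul_zero, zero_sub]

variable [NeZero n]

lemma v_add_one_eq (i : ZMod n) : P.v (i + 1) = zigzag x y ((i - i₀).val + 1) := by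
  rw [hP, zigzag_val_add_one hn hx hy]

lemma sum_edges_eq (F : ℤ × ℤ → ℤ × ℤ → ℤ) :
    ∑ i : ZMod n, F (P.v i) (P.v (i + 1)) = ∑ k ∈ Finset.range N,
      (F (x k, y k) (x (k + 1), y k) + F (x (k + 1), y k) (x (k + 1), y (k + 1))) := by
  rw [Finset.sum_congr rfl (g := fun i =>
    (fun m => F (zigzag x y m) (zigzag x y (m + 1))) (i - i₀).val)
    (fun i _ => by rw [v_add_one_eq hn hx hy hP, hP])]
  rw [sum_zmod_val_sub (fun m => F (zigzag x y m) (zigzag x y (m + 1))) i₀, hn, sum_range_two_mul]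
  refine Finset.sum_congr rfl fun k _ => ?_
  rw [show 2 * k + 1 + 1 = 2 * (k + 1) by ring]
  simp only [zigzag_even, zigzag_odd]

lemma ccw_iff : P.ccw ↔ 0 < ∑ k ∈ Finset.range N, y k * (x k - x (k + 1)) := by
  have h : ∑ i : ZMod n, cross (P.v i) (P.v (i + 1)) =
      2 * ∑ k ∈ Finset.range N, y k * (x k - x (k + 1)) := by
    rw [sum_edges_eq hn hx hy hP cross]
    have htel := Finset.sum_range_sub (fun k => x k * y k) N
    rw [hx, hy, sub_self] at htel
    rw [← sub_eq_zero, Finset.mul_sum, ← Finset.sum_sub_distrib, ← htel]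
    refine Finset.sum_congr rfl fun k _ => ?_
    simp only [cross]
    ring
  rw [ccw, h]
  omega

lemma perimeter_eq : P.perimeter = ∑ k ∈ Finset.range N, |x (k + 1) - x k| +
    ∑ k ∈ Finset.range N, |y (k + 1) - y k| := by
  rw [← Finset.sum_add_distrib]
  refine (sum_edges_eq hn hx hy hP fun u w => |w.1 - u.1| + |w.2 - u.2|).trans ?_
  simp

end sums

lemma exists_eq_add_natCast {n N : ℕ} [NeZero n] (hn : n = 2 * N) (i i₀ : ZMod n) :
    ∃ k < N, i = i₀ + (2 * k : ℕ) ∨ i = i₀ + (2 * k + 1 : ℕ) := by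
  have hlt : (i - i₀).val < n := ZMod.val_lt _
  have hi := eq_add_natCast_val i i₀
  obtain ⟨k, hk | hk⟩ := (i - i₀).val.even_or_odd'
  · exact ⟨k, by omega, Or.inl (hk ▸ hi)⟩
  · exact ⟨k, by omega, Or.inr (hk ▸ hi)⟩

lemma natCast_add_inj {n : ℕ} (i₀ : ZMod n) {k l : ℕ} (hk : k < n) (hl : l < n)
    (h : i₀ + (k : ZMod n) = i₀ + (l : ZMod n)) : k = l := by
  have := (ZMod.natCast_eq_natCast_iff' k l n).1 (add_left_cancel h)
  rwa [Nat.mod_eq_of_lt hk, Nat.mod_eq_of_lt hl] at this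

section extraction

variable {n : ℕ}

lemma horiz_add_natCast_iff (P : RectPolygon n) {i : ZMod n} (hi : P.horiz i) (m : ℕ) :
    P.horiz (i + m) ↔ Even m := by
  induction m with
  | zero => simpa using hi
  | succ m ih =>
    rw [Nat.cast_succ, ← add_assoc, ← vert_iff_horiz_add_one, Nat.even_add_one, ← ih,
      horiz_iff_not_vert, not_not]

lemma exists_bimonotone [NeZero n] (P : RectPolygon n) (hP : P.IsXMonotone) :
    ∃ (i₀ : ZMod n) (N a : ℕ) (x y : ℕ → ℤ), n = 2 * N ∧ Bimonotone N a x ∧ y N = y 0 ∧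
      (∀ k, k < N → y (k + 1) ≠ y k) ∧ ∀ i, P.v i = zigzag x y (i - i₀).val := by
  obtain ⟨u, w, -, hS⟩ := Set.ncard_eq_two.1 hP
  have hS' (i : ZMod n) : (P.horiz i ∧ P.sx i * P.sx (i + 2) < 0) ↔ i = u ∨ i = w := by
    simpa using Set.ext_iff.1 hS i
  have hu := (hS' u).2 (Or.inl rfl)
  have hne {i : ZMod n} (hi : P.horiz i) : P.sx i ≠ 0 := by
    rwa [Ne, ← vert_iff_sx, ← horiz_iff_not_vert]
  have hev {i : ZMod n} (hi : P.horiz i) (k : ℕ) : P.horiz (i + (2 * k : ℕ)) :=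
    (P.horiz_add_natCast_iff hi _).2 (even_two_mul k)
  obtain ⟨N, hn⟩ : ∃ N, n = 2 * N := by
    have := P.horiz_add_natCast_iff hu.1 n
    rw [ZMod.natCast_self, add_zero] at this
    exact (this.1 hu.1).two_dvd
  have hN : 0 < N := by have := NeZero.ne n; omega
  have hcyc (i : ZMod n) : i + 2 + (2 * (N - 1) : ℕ) = i := by
    have : ((2 * (N - 1) + 2 : ℕ) : ZMod n) = 0 := by
      rw [show 2 * (N - 1) + 2 = n by omega, ZMod.natCast_self]
    push_cast at this ⊢
    rw [add_assoc, add_comm 2, this, add_zero]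
  have hsucc (i : ZMod n) (k : ℕ) : i + (2 * (k + 1) : ℕ) = i + (2 * k : ℕ) + 2 := by
    push_cast
    ring
  obtain ⟨b, hb, hb1, hb2⟩ : ∃ b, P.horiz b ∧ P.sx b < 0 ∧ 0 < P.sx (b + 2) := by
    rcases lt_or_gt_of_ne (hne hu.1) with h | h
    · exact ⟨u, hu.1, h, pos_of_mul_neg_right hu.2 h.le⟩
    · have h2 : P.sx (u + 2) < 0 := by nlinarith [hu.2]
      have hex : ∃ k : ℕ, 0 < P.sx (u + 2 + (2 * k : ℕ)) := ⟨N - 1, by rwa [hcyc]⟩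
      have hu2 : P.horiz (u + 2) := by simpa using hev hu.1 1
      have hk := Nat.find_spec hex
      have hmin (m : ℕ) (hm : m < Nat.find hex) := Nat.find_min hex hm
      generalize Nat.find hex = k at hk hmin
      rcases k with - | k
      · simp only [mul_zero, Nat.cast_zero, add_zero] at hk
        omega
      · have h3 := hmin k (by omega)
        have h4 := hne (hev hu2 k)
        rw [hsucc] at hk
        exact ⟨_, hev hu2 k, by omega, hk⟩
  set i₀ := b + 2 with hi₀
  have hh : P.horiz i₀ := by simpa [hi₀] using hev hb 1
  have hlast : P.sx (i₀ + (2 * (N - 1) : ℕ)) < 0 := by rwa [hcyc]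
  have hex : ∃ k : ℕ, P.sx (i₀ + (2 * k : ℕ)) < 0 := ⟨N - 1, hlast⟩
  obtain ⟨a, ha, hmin, haN⟩ : ∃ a, P.sx (i₀ + (2 * a : ℕ)) < 0 ∧
      (∀ k, k < a → ¬ P.sx (i₀ + (2 * k : ℕ)) < 0) ∧ a ≤ N - 1 :=
    ⟨Nat.find hex, Nat.find_spec hex, fun k hk => Nat.find_min hex hk, Nat.find_min' hex hlast⟩
  have hpos (k : ℕ) (hk : k < a) : 0 < P.sx (i₀ + (2 * k : ℕ)) := by
    have h1 := hmin k hk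
    have h2 := hne (hev hh k)
    omega
  have ha0 : 0 < a := by
    rcases Nat.eq_zero_or_pos a with rfl | h
    · simp only [mul_zero, Nat.cast_zero, add_zero] at ha
      omega
    · exact h
  have hneg (k : ℕ) (hk : a ≤ k) (hkN : k < N) : P.sx (i₀ + (2 * k : ℕ)) < 0 := by
    induction k, hk using Nat.le_induction with
    | base => exact ha
    | succ k hk ih =>
      by_contra hc
      have h1 := ih (by omega)
      have h2 := hne (hev hh (k + 1))
      have hA := (hS' (i₀ + (2 * (a - 1) : ℕ))).1 ⟨hev hh _, by
        rw [← hsucc, show a - 1 + 1 = a by omega]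
        exact mul_neg_of_pos_of_neg (hpos _ (by omega)) ha⟩
      have hB := (hS' (i₀ + (2 * k : ℕ))).1 ⟨hev hh _, by
        rw [← hsucc]
        exact mul_neg_of_neg_of_pos h1 (by omega)⟩
      have hC := (hS' (i₀ + (2 * (N - 1) : ℕ))).1 ⟨hev hh _, by
        rw [hcyc]
        exact mul_neg_of_neg_of_pos hb1 hb2⟩
      have hinj (k l : ℕ) (hk : k < N) (hl : l < N)
          (h : i₀ + ((2 * k : ℕ) : ZMod n) = i₀ + ((2 * l : ℕ) : ZMod n)) : k = l := by
        have := natCast_add_inj i₀ (by omega) (by omega) h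
        omega
      have hAB := hinj (a - 1) k (by omega) (by omega)
      have hAC := hinj (a - 1) (N - 1) (by omega) (by omega)
      have hBC := hinj k (N - 1) (by omega) (by omega)
      have hAB' : a - 1 ≠ k := by omega
      have hAC' : a - 1 ≠ N - 1 := by omega
      have hBC' : k ≠ N - 1 := by omega
      rcases hA with hA | hA <;> rcases hB with hB | hB <;> rcases hC with hC | hC <;>
        first
          | exact hAB' (hAB (hA.trans hB.symm))
          | exact hAC' (hAC (hA.trans hC.symm))
          | exact hBC' (hBC (hB.trans hC.symm))
  have hodd (k : ℕ) : i₀ + (2 * k + 1 : ℕ) = i₀ + (2 * k : ℕ) + 1 := by push_cast; ring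
  have hhor (k : ℕ) : (P.v (i₀ + (2 * k + 1 : ℕ))).2 = (P.v (i₀ + (2 * k : ℕ))).2 := by
    rw [hodd]
    exact hev hh k
  have hver (k : ℕ) : (P.v (i₀ + (2 * (k + 1) : ℕ))).1 = (P.v (i₀ + (2 * k + 1 : ℕ))).1 := by
    have := (P.horiz_iff_vert_add_one _).1 (hev hh k)
    rw [vert, add_assoc _ 1 1, one_add_one_eq_two] at this
    rw [hsucc, hodd, this]
  have hver' (k : ℕ) : (P.v (i₀ + (2 * (k + 1) : ℕ))).2 ≠ (P.v (i₀ + (2 * k + 1 : ℕ))).2 := by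
    intro h
    refine P.nondeg (i₀ + (2 * k + 1 : ℕ)) ?_
    rw [show i₀ + (2 * k + 1 : ℕ) + 1 = i₀ + (2 * (k + 1) : ℕ) by push_cast; ring]
    exact Prod.ext (hver k) h
  have hdx (k : ℕ) : P.sx (i₀ + (2 * k : ℕ)) =
      (P.v (i₀ + (2 * (k + 1) : ℕ))).1 - (P.v (i₀ + (2 * k : ℕ))).1 := by
    rw [sx, ← hodd, hver]
  have hNn : i₀ + (2 * N : ℕ) = i₀ + (2 * 0 : ℕ) := by
    rw [← hn, ZMod.natCast_self]
    simp
  refine ⟨i₀, N, a, fun k => (P.v (i₀ + (2 * k : ℕ))).1, fun k => (P.v (i₀ + (2 * k : ℕ))).2, hn,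
    ⟨ha0, by omega, by rw [hNn], fun k hk => ?_, fun k hk hkN => ?_⟩, by simp only [hNn],
    fun k _ => ?_, fun i => ?_⟩
  · have := hpos k hk
    rw [hdx] at this
    omega
  · have := hneg k hk hkN
    rw [hdx] at this
    omega
  · have := hver' k
    rwa [hhor] at this
  · have hi := eq_add_natCast_val i i₀
    obtain ⟨k, hk | hk⟩ := (i - i₀).val.even_or_odd'
    · rw [hk, zigzag_even]
      rw [hk] at hi
      rw [hi]
    · rw [hk, zigzag_odd, hver, ← hhor]
      rw [hk] at hi
      rw [hi]

variable {N a : ℕ} {x y : ℕ → ℤ} {P : RectPolygon n} {i₀ : ZMod n}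

lemma adjacent_of_onSeg (hn : n = 2 * N) (hx : x N = x 0) (hy : y N = y 0)
    (hP : ∀ i, P.v i = zigzag x y (i - i₀).val) {k l : ℕ} (hk : k < 2 * N) (hl : l < 2 * N)
    (hkl : k ≠ l) {p : ℤ × ℤ} (h1 : onSeg (zigzag x y k) (zigzag x y (k + 1)) p)
    (h2 : onSeg (zigzag x y l) (zigzag x y (l + 1)) p) :
    l = k + 1 ∨ k = l + 1 ∨ (k = 0 ∧ l + 1 = 2 * N) ∨ (l = 0 ∧ k + 1 = 2 * N) := by
  have hnext (k l : ℕ) (hk : k < 2 * N) (hl : l < 2 * N)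
      (h : i₀ + (l : ZMod n) = i₀ + (k : ZMod n) + 1) : l = k + 1 ∨ (l = 0 ∧ k + 1 = 2 * N) := by
    rcases (show k + 1 ≤ 2 * N from hk).lt_or_eq with hlt | heq
    · exact Or.inl (natCast_add_inj i₀ (by omega) (by omega) (by push_cast; rw [h, add_assoc]))
    · refine Or.inr ⟨natCast_add_inj i₀ (by omega) (by omega) ?_, heq⟩
      rw [h, add_assoc, ← Nat.cast_succ, Nat.succ_eq_add_one, heq, ← hn]
      simp
  rcases P.simple (i₀ + k) (i₀ + l) (fun h => hkl (natCast_add_inj i₀ (by omega) (by omega) h.symm))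
    p (by rwa [v_natCast_eq hn hx hy hP hk.le, v_natCast_add_one_eq hn hx hy hP hk])
    (by rwa [v_natCast_eq hn hx hy hP hl.le, v_natCast_add_one_eq hn hx hy hP hl]) with h | h
  · have := hnext k l hk hl h.1
    omega
  · have := hnext l k hl hk h.1
    omega

lemma separated_of_ccw [NeZero n] (hn : n = 2 * N) (hx : Bimonotone N a x) (hy : y N = y 0)
    (hP : ∀ i, P.v i = zigzag x y (i - i₀).val) (hccw : P.ccw) : Separated N a x y := by
  have hadj {k l : ℕ} {p : ℤ × ℤ} := adjacent_of_onSeg hn hx.closed hy hP (k := k) (l := l) (p := p)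
  have hlt := hx.lt
  rw [ccw_iff hn hx.closed hy hP] at hccw
  refine (hx.separated_or (y := y) ?_ ?_ ?_).resolve_right fun h => ?_
  · intro p q hp hq hqN h1 h2 hpq
    have h3 := hx.up p hp
    have h4 := hx.down q hq hqN
    have := @hadj (2 * p) (2 * q) (max (x p) (x (q + 1)), y p) (by omega) (by omega) (by omega)
      (onSeg_zigzag_even.2 (by refine ⟨?_, ?_, ?_⟩ <;> simp only <;> omega)) (onSeg_zigzag_even.2 (by refine ⟨?_, ?_, ?_⟩ <;> simp only <;> omega))
    omega
  · intro p q hp hq hqN h1 h2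
    have h4 := hx.down q hq hqN
    by_contra hc
    have := @hadj (2 * p + 1) (2 * q) (x (p + 1), y q) (by omega) (by omega) (by omega)
      (onSeg_zigzag_odd.2 (by refine ⟨?_, ?_, ?_⟩ <;> simp only <;> omega)) (onSeg_zigzag_even.2 (by refine ⟨?_, ?_, ?_⟩ <;> simp only <;> omega))
    omega
  · intro p q hp hq hqN h1 h2
    have h3 := hx.up p hp
    by_contra hc
    have := @hadj (2 * p) (2 * q + 1) (x (q + 1), y p) (by omega) (by omega) (by omega)
      (onSeg_zigzag_even.2 (by refine ⟨?_, ?_, ?_⟩ <;> simp only <;> omega)) (onSeg_zigzag_odd.2 (by refine ⟨?_, ?_, ?_⟩ <;> simp only <;> omega))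
    omega
  · have := hx.area_pos h
    simp only [neg_mul, Finset.sum_neg_distrib] at this
    omega

end extraction

section canonical

variable {N a : ℕ} {x y : ℕ → ℤ}

lemma Bimonotone.sum_range_eq (h : Bimonotone N a x) (f : ℕ → ℤ) :
    ∑ k ∈ Finset.range N, f k = ∑ k ∈ Finset.range (a - 1), f k + f (a - 1) +
      (∑ k ∈ Finset.Ico a (N - 1), f k + f (N - 1)) := by
  have := h.pos
  have := h.lt
  rw [← Finset.sum_range_succ, ← Finset.sum_Ico_succ_top (by omega), show a - 1 + 1 = a by omega,
    show N - 1 + 1 = N by omega, Finset.sum_range_add_sum_Ico _ h.lt.le]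

lemma Bimonotone.sum_abs (h : Bimonotone N a x) :
    ∑ k ∈ Finset.range N, |x (k + 1) - x k| = 2 * (x a - x 0) := by
  rw [← Finset.sum_range_add_sum_Ico _ h.lt.le,
    Finset.sum_congr rfl (g := fun k => x (k + 1) - x k)
      (fun k hk => abs_of_pos (sub_pos.2 (h.up k (Finset.mem_range.1 hk)))),
    Finset.sum_congr (s₁ := Finset.Ico a N) rfl (g := fun k => -(x (k + 1) - x k))
      (fun k hk => abs_of_neg (sub_neg.2 (h.down k (Finset.mem_Ico.1 hk).1 (Finset.mem_Ico.1 hk).2))),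
    Finset.sum_neg_distrib, Finset.sum_range_sub, Finset.sum_Ico_sub _ h.lt.le, h.closed]
  ring

lemma Bimonotone.sign_congr {x' : ℕ → ℤ} (h : Bimonotone N a x) (h' : Bimonotone N a x') {k : ℕ}
    (hk : k < N) : (x (k + 1) - x k).sign = (x' (k + 1) - x' k).sign := by
  rcases lt_or_ge k a with hka | hka
  · rw [Int.sign_eq_one_of_pos (sub_pos.2 (h.up k hka)),
      Int.sign_eq_one_of_pos (sub_pos.2 (h'.up k hka))]
  · rw [Int.sign_eq_neg_one_of_neg (sub_neg.2 (h.down k hka hk)),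
      Int.sign_eq_neg_one_of_neg (sub_neg.2 (h'.down k hka hk))]

lemma Separated.right (hs : Separated N a x y) (h : Bimonotone N a x) : y (a - 1) < y a := by
  have := h.pos
  have hup := h.up (a - 1) (by omega)
  have := h.down a le_rfl h.lt
  have ha : a - 1 + 1 = a := by omega
  rw [ha] at hup
  exact hs (a - 1) a (by omega) le_rfl h.lt (by omega) (by rw [ha]; omega)

lemma Separated.left (hs : Separated N a x y) (h : Bimonotone N a x) : y 0 < y (N - 1) := by
  have := h.pos
  have := h.lt
  have := h.up 0 (by omega)
  have hdown := h.down (N - 1) (by omega) (by omega)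
  have hN : N - 1 + 1 = N := by omega
  rw [hN, h.closed] at hdown
  exact hs 0 (N - 1) (by omega) (by omega) (by omega) (by omega) (by rw [hN, h.closed]; omega)

/-- Abscissae of the canonical polygon: upper edges get unit length, and the `k`-th lower
breakpoint is moved left just as far as this requires. -/
def canonicalX (N a : ℕ) (x : ℕ → ℤ) (k : ℕ) : ℤ :=
  if k ≤ a then min (x k - x 0) (k + N - 2 * a) else N - k

/-- The amount by which the `k`-th vertical edge exceeds unit length, with its direction. -/
def excess (y : ℕ → ℤ) (k : ℕ) : ℤ := y (k + 1) - y k - (y (k + 1) - y k).sign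

/-- The total excess of the vertical edges that would bring the two chains closer together
when shortened. -/
def totalExcess (N a : ℕ) (y : ℕ → ℤ) : ℤ :=
  ∑ k ∈ Finset.range (a - 1), max 0 (-excess y k) +
    ∑ k ∈ Finset.Ico a (N - 1), max 0 (-excess y k)

/-- Heights of the canonical polygon: inner vertical edges get unit length, and the upper chain
is raised to compensate. -/
def canonicalY (N a : ℕ) (x y : ℕ → ℤ) (k : ℕ) : ℤ :=
  if k < a then y k - ∑ i ∈ Finset.range k, excess y i
  else if k < N then y k + totalExcess N a y + (x a - x 0 - (N - a)) +
    ∑ i ∈ Finset.Ico k (N - 1), excess y i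
  else y 0

lemma canonicalX_of_le {k : ℕ} (hk : k ≤ a) :
    canonicalX N a x k = min (x k - x 0) (k + N - 2 * a) := if_pos hk

lemma canonicalX_of_ge (h : Bimonotone N a x) {k : ℕ} (hk : a ≤ k) :
    canonicalX N a x k = N - k := by
  rcases hk.eq_or_lt with rfl | hlt
  · have := h.le_add le_rfl h.lt.le le_rfl
    rw [h.closed] at this
    rw [canonicalX_of_le le_rfl]
    omega
  · rw [canonicalX, if_neg (by omega)]

lemma bimonotone_canonicalX (h : Bimonotone N a x) (haN : 2 * a ≤ N) :
    Bimonotone N a (canonicalX N a x) where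
  pos := h.pos
  lt := h.lt
  closed := by
    rw [canonicalX_of_ge h h.lt.le, canonicalX_of_le (Nat.zero_le a)]
    push_cast
    omega
  up k hk := by
    have := h.up k hk
    rw [canonicalX_of_le hk.le, canonicalX_of_le (show k + 1 ≤ a from hk)]
    push_cast
    omega
  down k hk _ := by
    rw [canonicalX_of_ge h hk, canonicalX_of_ge h (by omega)]
    push_cast
    omega

lemma canonicalY_sub {k : ℕ} (hk : k + 1 ≠ a) (hkN : k + 1 < N) :
    canonicalY N a x y (k + 1) - canonicalY N a x y k = (y (k + 1) - y k).sign := by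
  unfold canonicalY
  rcases lt_or_ge k a with hka | hka
  · rw [if_pos (by omega), if_pos hka, Finset.sum_range_succ, excess]
    ring
  · rw [if_neg (by omega : ¬ k + 1 < a), if_pos hkN, if_neg (by omega : ¬ k < a),
      if_pos (by omega : k < N),
      Finset.sum_eq_sum_Ico_succ_bot (show k < N - 1 by omega), excess]
    ring

lemma canonicalY_le_add {p q : ℕ} (hpq : p ≤ q) (hq : q < a) (haN : a < N) :
    canonicalY N a x y p ≤ canonicalY N a x y q + (q - p) ∧
      canonicalY N a x y q ≤ canonicalY N a x y p + (q - p) := by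
  induction q, hpq using Nat.le_induction with
  | base => simp
  | succ q hpq ih =>
    have := ih (by omega)
    have h1 := canonicalY_sub (x := x) (y := y) (N := N) (a := a) (k := q) (by omega) (by omega)
    have h2 := Int.sign_trichotomy (y (q + 1) - y q)
    push_cast
    omega

lemma canonicalY_sub_ge {p q : ℕ} (hp : p < a) (hq : a ≤ q) (hqN : q < N) :
    y q - y p + (x a - x 0 - (N - a)) ≤ canonicalY N a x y q - canonicalY N a x y p := by
  have h1 : -∑ i ∈ Finset.range (a - 1), max 0 (-excess y i) ≤
      ∑ i ∈ Finset.range p, excess y i := by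
    rw [← Finset.sum_neg_distrib]
    have hsub : Finset.range p ⊆ Finset.range (a - 1) := Finset.range_subset_range.2 (by omega)
    calc ∑ i ∈ Finset.range (a - 1), -max 0 (-excess y i)
        ≤ ∑ i ∈ Finset.range p, -max 0 (-excess y i) := by
          rw [Finset.sum_neg_distrib, Finset.sum_neg_distrib, neg_le_neg_iff]
          exact Finset.sum_le_sum_of_subset_of_nonneg hsub fun i _ _ => le_max_left _ _
      _ ≤ _ := Finset.sum_le_sum fun i _ => by omega
  have h2 : -∑ i ∈ Finset.Ico a (N - 1), max 0 (-excess y i) ≤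
      ∑ i ∈ Finset.Ico q (N - 1), excess y i := by
    rw [← Finset.sum_neg_distrib]
    have hsub : Finset.Ico q (N - 1) ⊆ Finset.Ico a (N - 1) := Finset.Ico_subset_Ico_left hq
    calc ∑ i ∈ Finset.Ico a (N - 1), -max 0 (-excess y i)
        ≤ ∑ i ∈ Finset.Ico q (N - 1), -max 0 (-excess y i) := by
          rw [Finset.sum_neg_distrib, Finset.sum_neg_distrib, neg_le_neg_iff]
          exact Finset.sum_le_sum_of_subset_of_nonneg hsub fun i _ _ => le_max_left _ _
      _ ≤ _ := Finset.sum_le_sum fun i _ => by omega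
  rw [canonicalY, canonicalY, if_pos hp, if_neg (by omega), if_pos hqN, totalExcess]
  linarith

/-- If a lower and an upper edge meet after compression, then the upper edge met, before
compression, a lower edge whose index differs by at most the loss of width. -/
lemma exists_near_of_canonicalX (h : Bimonotone N a x) {p q : ℕ} (hp : p < a) (hq : a ≤ q)
    (hqN : q < N) (h1 : canonicalX N a x p ≤ canonicalX N a x q)
    (h2 : canonicalX N a x (q + 1) ≤ canonicalX N a x (p + 1)) :
    ∃ r < a, x r ≤ x q ∧ x (q + 1) ≤ x (r + 1) ∧
      (p : ℤ) - r ≤ x a - x 0 - (N - a) ∧ (r : ℤ) - p ≤ x a - x 0 - (N - a) := by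
  rw [canonicalX_of_ge h hq, canonicalX_of_le hp.le] at h1
  rw [canonicalX_of_ge h (by omega), canonicalX_of_le (by omega)] at h2
  push_cast at h1 h2
  have hdown := h.down q hq hqN
  have hpa := h.add_le hp.le le_rfl
  have hqx := h.le_add hq hqN.le le_rfl
  have hqx' := h.le_add le_rfl (show a ≤ q + 1 by omega) (by omega)
  have hw := h.le_add le_rfl h.lt.le le_rfl
  rw [h.closed] at hqx hw
  by_cases hA : x q < x p
  · have hex : ∃ m, x q < x m := ⟨p, hA⟩
    have hm := Nat.find_spec hex
    have hmin (m : ℕ) (hm : m < Nat.find hex) := Nat.find_min hex hm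
    have hmp := Nat.find_min' hex hA
    generalize Nat.find hex = m at hm hmin hmp
    rcases m with - | r
    · have := (h.bounds hqN.le).1
      omega
    · have h3 := hmin r (by omega)
      have h4 := h.add_le hmp hp.le
      push_cast at h4
      exact ⟨r, by omega, by omega, by omega, by omega, by omega⟩
  · by_cases hB : x (p + 1) < x (q + 1)
    · have hqa : x (q + 1) ≤ x a := (h.bounds (by omega)).2
      have hex : ∃ m, x (q + 1) ≤ x m := ⟨a, hqa⟩
      have hm := Nat.find_spec hex
      have hmin (m : ℕ) (hm : m < Nat.find hex) := Nat.find_min hex hm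
      have hma := Nat.find_min' hex hqa
      generalize Nat.find hex = m at hm hmin hma
      have hpm : p + 1 < m := by
        by_contra hc
        have := h.add_le (not_lt.1 hc) hp
        push_cast at *
        omega
      rcases m with - | r
      · omega
      · have h3 := hmin r (by omega)
        have h4 := h.add_le (i := p + 1) (j := r) (by omega) (by omega)
        push_cast at h4 hqx'
        exact ⟨r, by omega, by omega, by omega, by omega, by omega⟩
    · exact ⟨p, hp, by omega, by omega, by omega, by omega⟩

lemma separated_canonical (h : Bimonotone N a x) (hs : Separated N a x y) :
    Separated N a (canonicalX N a x) (canonicalY N a x y) := by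
  intro p q hp hq hqN h1 h2
  obtain ⟨r, hr, h3, h4, h5, h6⟩ := exists_near_of_canonicalX h hp hq hqN h1 h2
  have h7 := hs r q hr hq hqN h3 h4
  have h8 := canonicalY_sub_ge (x := x) (y := y) hr hq hqN
  rcases le_total p r with hpr | hpr
  · have := (canonicalY_le_add (x := x) (y := y) hpr hr h.lt).1
    omega
  · have := (canonicalY_le_add (x := x) (y := y) hpr hp h.lt).2
    omega

lemma canonicalY_closed (h : Bimonotone N a x) : canonicalY N a x y N = canonicalY N a x y 0 := by
  have := h.pos
  have := h.lt
  simp [canonicalY, h.pos, show ¬ N < a by omega]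

lemma sign_canonicalY_sub (h : Bimonotone N a x) (hs : Separated N a x y) (haN : 2 * a ≤ N)
    (hy : y N = y 0) {k : ℕ} (hk : k < N) :
    (canonicalY N a x y (k + 1) - canonicalY N a x y k).sign = (y (k + 1) - y k).sign := by
  have hs' := separated_canonical h hs
  have h' := bimonotone_canonicalX h haN
  by_cases hka : k + 1 = a
  · obtain rfl : k = a - 1 := by omega
    rw [hka, Int.sign_eq_one_of_pos (sub_pos.2 (hs.right h)),
      Int.sign_eq_one_of_pos (sub_pos.2 (hs'.right h'))]
  · by_cases hkN : k + 1 = N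
    · obtain rfl : k = N - 1 := by omega
      rw [hkN, hy, canonicalY_closed h, Int.sign_eq_neg_one_of_neg (sub_neg.2 (hs.left h)),
        Int.sign_eq_neg_one_of_neg (sub_neg.2 (hs'.left h'))]
    · rw [canonicalY_sub hka (by omega), Int.sign_sign]

lemma abs_sign_sub {d : ℤ} (hd : d ≠ 0) :
    |d.sign| = |d| - (d - d.sign) - 2 * max 0 (-(d - d.sign)) := by
  rcases lt_or_gt_of_ne hd with h | h
  · rw [Int.sign_eq_neg_one_of_neg h, abs_of_neg h]
    simp only [abs_neg, abs_one]
    omega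
  · rw [Int.sign_eq_one_of_pos h, abs_of_pos h]
    simp only [abs_one]
    omega

lemma sum_abs_canonicalY (h : Bimonotone N a x) (hs : Separated N a x y) (haN : 2 * a ≤ N)
    (hyN : y N = y 0) (hy : ∀ k, k < N → y (k + 1) ≠ y k) :
    ∑ k ∈ Finset.range N, |canonicalY N a x y (k + 1) - canonicalY N a x y k| =
      ∑ k ∈ Finset.range N, |y (k + 1) - y k| + 2 * (x a - x 0 - (N - a)) := by
  have hs' := separated_canonical h hs
  have h' := bimonotone_canonicalX h haN
  have hpos := h.pos
  have hlt := h.lt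
  have hinner {k : ℕ} (hk : k + 1 ≠ a) (hkN : k + 1 < N) :
      |canonicalY N a x y (k + 1) - canonicalY N a x y k| =
        |y (k + 1) - y k| - excess y k - 2 * max 0 (-excess y k) := by
    rw [canonicalY_sub hk hkN, abs_sign_sub (sub_ne_zero.2 (hy k (by omega)))]
    rfl
  rw [h.sum_range_eq, h.sum_range_eq,
    Finset.sum_congr rfl fun k hk => hinner (by have := Finset.mem_range.1 hk; omega)
      (by have := Finset.mem_range.1 hk; omega),
    Finset.sum_congr (s₁ := Finset.Ico a (N - 1)) rfl fun k hk =>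
      hinner (by have := Finset.mem_Ico.1 hk; omega) (by have := Finset.mem_Ico.1 hk; omega),
    show a - 1 + 1 = a by omega, show N - 1 + 1 = N by omega, hyN, canonicalY_closed h,
    abs_of_pos (sub_pos.2 (hs.right h)), abs_of_pos (sub_pos.2 (hs'.right h')),
    abs_of_neg (sub_neg.2 (hs.left h)), abs_of_neg (sub_neg.2 (hs'.left h'))]
  simp only [Finset.sum_sub_distrib, ← Finset.mul_sum]
  simp only [canonicalY, lt_irrefl, if_false, hlt, if_true, hpos, show a - 1 < a by omega,
    show ¬ N - 1 < a by omega, show N - 1 < N by omega, Finset.range_zero, Finset.sum_empty,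
    Finset.Ico_self, totalExcess]
  ring

end canonical

section reflex

variable {n N a : ℕ} [NeZero n] {x y : ℕ → ℤ} {P : RectPolygon n} {i₀ : ZMod n}

/-- The index of the last vertex of the `k`-th vertical edge if `s k` holds, and of its first
vertex otherwise. -/
def reflexIndex (s : ℕ → Prop) [DecidablePred s] (k : ℕ) : ℕ :=
  if s k then 2 * (k + 1) else 2 * k + 1

lemma rT_le (hn : n = 2 * N) (hx : Bimonotone N a x) (hs : Separated N a x y) (hyN : y N = y 0)
    (hP : ∀ i, P.v i = zigzag x y (i - i₀).val) : P.rT ≤ N - 1 - a := by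
  have hpos := hx.pos
  have hlt := hx.lt
  have hsub : {i : ZMod n | P.upperReflex i} ⊆ ((Finset.Ico a (N - 1)).image fun k =>
      i₀ + (reflexIndex (fun k => y (k + 1) < y k) k : ZMod n) : Finset (ZMod n)) := by
    intro i hi
    obtain ⟨hr, hi⟩ := hi
    simp only [Finset.coe_image, Set.mem_image, Finset.coe_Ico, Set.mem_Ico]
    obtain ⟨k, hk, rfl | rfl⟩ := exists_eq_add_natCast hn i i₀
    · have hsy := sy_even hn hx.closed hyN hP hk
      have hneg : P.sx (i₀ + (2 * k : ℕ)) < 0 := by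
        rcases hi with ⟨hh, -⟩ | ⟨-, hi⟩
        · rw [horiz_iff_vert_add_one, sub_add_cancel] at hh
          exact absurd hh ((P.horiz_iff_not_vert _).1 ((P.horiz_iff_sy _).2 hsy))
        · exact hi
      rw [sx_even hn hx.closed hyN hP hk] at hneg
      have hka : a ≤ k := by
        by_contra hc
        have := hx.up k (by omega)
        omega
      obtain ⟨k, rfl⟩ := Nat.exists_eq_add_one_of_ne_zero (show k ≠ 0 by omega)
      rw [reflexAt, cross_even hn hx.closed hyN hP hk] at hr
      have hyk : y (k + 1) < y k := by
        simp only [add_assoc, Nat.reduceAdd] at hneg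
        nlinarith
      have hka' : a ≤ k := by
        by_contra hc
        obtain rfl : k = a - 1 := by omega
        have := hs.right hx
        rw [show a - 1 + 1 = a by omega] at hyk
        omega
      exact ⟨k, ⟨hka', by omega⟩, by rw [reflexIndex, if_pos hyk]⟩
    · have hsy := sx_odd hn hx.closed hyN hP hk
      have hpred : i₀ + (2 * k + 1 : ℕ) - 1 = i₀ + (2 * k : ℕ) := by push_cast; ring
      have hneg : P.sx (i₀ + (2 * k : ℕ)) < 0 := by
        rcases hi with ⟨-, hi⟩ | ⟨-, hi⟩
        · rwa [hpred] at hi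
        · omega
      rw [sx_even hn hx.closed hyN hP hk] at hneg
      have hka : a ≤ k := by
        by_contra hc
        have := hx.up k (by omega)
        omega
      rw [reflexAt, cross_odd hn hx.closed hyN hP hk] at hr
      have hyk : y k < y (k + 1) := by nlinarith
      have hkN : k ≠ N - 1 := by
        rintro rfl
        have := hs.left hx
        rw [show N - 1 + 1 = N by omega, hyN] at hyk
        omega
      exact ⟨k, ⟨hka, by omega⟩, by rw [reflexIndex, if_neg (by omega)]⟩
  refine (Set.ncard_le_ncard hsub (Finset.finite_toSet _)).trans ?_
  rw [Set.ncard_coe_finset]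
  exact Finset.card_image_le.trans (by rw [Nat.card_Ico])

lemma le_rB (hn : n = 2 * N) (hx : Bimonotone N a x) (hyN : y N = y 0)
    (hy : ∀ k, k < N → y (k + 1) ≠ y k)
    (hP : ∀ i, P.v i = zigzag x y (i - i₀).val) : a - 1 ≤ P.rB := by
  have hlt := hx.lt
  have hsub : (((Finset.range (a - 1)).image fun k =>
      i₀ + (reflexIndex (fun k => y k < y (k + 1)) k : ZMod n) : Finset (ZMod n)) : Set (ZMod n)) ⊆
      {i : ZMod n | P.lowerReflex i} := by
    intro i hi
    simp only [Finset.coe_image, Set.mem_image, Finset.coe_range, Set.mem_Iio] at hi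
    obtain ⟨k, hk, rfl⟩ := hi
    have hk1 := hx.up k (by omega)
    have hk2 := hx.up (k + 1) (by omega)
    rw [Set.mem_ofPred_eq, reflexIndex]
    split_ifs with hyk
    · refine ⟨?_, Or.inr ⟨?_, ?_⟩⟩
      · rw [reflexAt, cross_even hn hx.closed hyN hP (by omega)]
        simp only [add_assoc, Nat.reduceAdd] at hk2
        nlinarith
      · rw [horiz_iff_sy, sy_even hn hx.closed hyN hP (by omega)]
      · rw [sx_even hn hx.closed hyN hP (by omega)]
        omega
    · have hpred : i₀ + (2 * k + 1 : ℕ) - 1 = i₀ + (2 * k : ℕ) := by push_cast; ring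
      have := hy k (by omega)
      refine ⟨?_, Or.inl ⟨?_, ?_⟩⟩
      · rw [reflexAt, cross_odd hn hx.closed hyN hP (by omega)]
        exact mul_neg_of_pos_of_neg (by omega) (by omega)
      · rw [hpred, horiz_iff_sy, sy_even hn hx.closed hyN hP (by omega)]
      · rw [hpred, sx_even hn hx.closed hyN hP (by omega)]
        omega
  have hcard := Set.ncard_le_ncard hsub (Set.toFinite _)
  rw [Set.ncard_coe_finset, Finset.card_image_of_injOn, Finset.card_range] at hcard
  · exact hcard
  · intro k hk l hl hkl
    simp only [Finset.coe_range, Set.mem_Iio] at hk hl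
    simp only [reflexIndex] at hkl
    have := natCast_add_inj i₀ (by split_ifs <;> omega) (by split_ifs <;> omega) hkl
    split_ifs at this <;> omega

end reflex

section signs

variable {n N : ℕ} [NeZero n] {x y x' y' : ℕ → ℤ} {P Q : RectPolygon n} {i₀ : ZMod n}

lemma sign_eq_of_zigzag (hn : n = 2 * N) (hx : x N = x 0) (hy : y N = y 0)
    (hP : ∀ i, P.v i = zigzag x y (i - i₀).val) (hx' : x' N = x' 0) (hy' : y' N = y' 0)
    (hQ : ∀ i, Q.v i = zigzag x' y' (i - i₀).val)
    (hsx : ∀ k, k < N → (x (k + 1) - x k).sign = (x' (k + 1) - x' k).sign)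
    (hsy : ∀ k, k < N → (y (k + 1) - y k).sign = (y' (k + 1) - y' k).sign) (i : ZMod n) :
    (P.sx i).sign = (Q.sx i).sign ∧ (P.sy i).sign = (Q.sy i).sign := by
  obtain ⟨k, hk, rfl | rfl⟩ := exists_eq_add_natCast hn i i₀
  · rw [sx_even hn hx hy hP hk, sx_even hn hx' hy' hQ hk, sy_even hn hx hy hP hk,
      sy_even hn hx' hy' hQ hk]
    exact ⟨hsx k hk, rfl⟩
  · rw [sx_odd hn hx hy hP hk, sx_odd hn hx' hy' hQ hk, sy_odd hn hx hy hP hk,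
      sy_odd hn hx' hy' hQ hk]
    exact ⟨rfl, hsy k hk⟩

lemma fst_mem_bounds {a : ℕ} (hn : n = 2 * N) (hx : Bimonotone N a x) (hy : y N = y 0)
    (hP : ∀ i, P.v i = zigzag x y (i - i₀).val) (i : ZMod n) :
    x 0 ≤ (P.v i).1 ∧ (P.v i).1 ≤ x a := by
  obtain ⟨k, hk, rfl | rfl⟩ := exists_eq_add_natCast hn i i₀
  · rw [v_natCast_eq hn hx.closed hy hP (by omega), zigzag_even]
    exact hx.bounds hk.le
  · rw [v_natCast_eq hn hx.closed hy hP (by omega), zigzag_odd]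
    exact hx.bounds hk

lemma periCanonical_of_zigzag {a : ℕ} (hn : n = 2 * N) (hx : Bimonotone N a x) (hy : y N = y 0)
    (hP : ∀ i, P.v i = zigzag x y (i - i₀).val)
    (hver : ∀ k, k + 1 ≠ a → k + 1 < N → |y (k + 1) - y k| = 1)
    (hhor : ∀ k, a ≤ k → k < N → |x (k + 1) - x k| = 1) : periCanonical P := by
  have helen (i : ZMod n) : P.elen i = |P.sx i| + |P.sy i| := rfl
  have hb := fst_mem_bounds hn hx hy hP
  refine ⟨fun i hi hmin hmax => ?_, fun i hi hneg => ?_⟩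
  · obtain ⟨k, hk, rfl | rfl⟩ := exists_eq_add_natCast hn i i₀
    · rw [vert_iff_sx, sx_even hn hx.closed hy hP hk] at hi
      exact absurd (sub_eq_zero.1 hi) (hx.ne k hk)
    · have hv : (P.v (i₀ + (2 * k + 1 : ℕ))).1 = x (k + 1) := by
        rw [v_natCast_eq hn hx.closed hy hP (by omega), zigzag_odd]
      rw [helen, sx_odd hn hx.closed hy hP hk, sy_odd hn hx.closed hy hP hk, abs_zero, zero_add]
      refine hver k (fun hka => hmax ?_) (lt_of_le_of_ne hk fun hkN => hmin ?_)
      · refine le_antisymm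
          (Finset.le_sup' (fun i : ZMod n => (P.v i).1) (Finset.mem_univ _)) ?_
        exact Finset.sup'_le _ _ fun j _ => by rw [hv, hka]; exact (hb j).2
      · refine le_antisymm ?_
          (Finset.inf'_le (fun i : ZMod n => (P.v i).1) (Finset.mem_univ _))
        exact Finset.le_inf' _ _ fun j _ => by
          rw [hv, show k + 1 = N from hkN, hx.closed]; exact (hb j).1
  · obtain ⟨k, hk, rfl | rfl⟩ := exists_eq_add_natCast hn i i₀
    · rw [sx_even hn hx.closed hy hP hk] at hneg
      rw [helen, sx_even hn hx.closed hy hP hk, sy_even hn hx.closed hy hP hk, abs_zero, add_zero]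
      refine hhor k (not_lt.1 fun hka => ?_) hk
      have := hx.up k hka
      omega
    · rw [sx_odd hn hx.closed hy hP hk] at hneg
      exact absurd hneg (lt_irrefl 0)

end signs

end RectPolygon

/-- Any x-monotone rectilinear polygon (with `r(T) ≥ r(B)`) can be transformed
into a perimeter-canonical x-monotone polygon realizing the same angle sequence
without increasing its perimeter. -/
theorem x_monotone_to_perimeter_canonical (n : ℕ) [NeZero n] (P : RectPolygon n)
    (hccw : P.ccw) (hx : P.IsXMonotone) (hTB : P.rB ≤ P.rT) :
    ∃ P' : RectPolygon n, P'.ccw ∧ P'.IsXMonotone ∧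
      (∀ i : ZMod n, (P.convexAt i ↔ P'.convexAt i) ∧ (P.reflexAt i ↔ P'.reflexAt i)) ∧
      periCanonical P' ∧ P'.perimeter ≤ P.perimeter := by
  open RectPolygon in
  obtain ⟨i₀, N, a, x, y, hn, hm, hyN, hy, hP⟩ := P.exists_bimonotone hx
  have hs := separated_of_ccw hn hm hyN hP hccw
  have haN : 2 * a ≤ N := by
    have := rT_le hn hm hs hyN hP
    have := le_rB hn hm hyN hy hP
    have := hm.pos
    have := hm.lt
    omega
  have hm' := bimonotone_canonicalX hm haN
  have hs' := separated_canonical hm hs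
  have hyN' := canonicalY_closed (y := y) hm
  have hsign {k : ℕ} (hk : k < N) := sign_canonicalY_sub hm hs haN hyN hk
  have hy' (k : ℕ) (hk : k < N) : canonicalY N a x y (k + 1) ≠ canonicalY N a x y k := by
    have := hsign hk
    have := Int.sign_eq_zero_iff_zero.not.2 (sub_ne_zero.2 (hy k hk))
    rw [← sub_ne_zero, Ne, ← Int.sign_eq_zero_iff_zero]
    omega
  obtain ⟨Q, hQ⟩ := exists_eq_zigzag hn i₀ hm' hs' hyN' hy'
  have hsgn := sign_eq_of_zigzag hn hm.closed hyN hP hm'.closed hyN' hQ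
    (fun k hk => hm.sign_congr hm' hk) (fun k hk => (hsign hk).symm)
  refine ⟨Q, (ccw_iff hn hm'.closed hyN' hQ).2 (hm'.area_pos hs'),
    (isXMonotone_congr (fun i => (hsgn i).1) fun i => (hsgn i).2).1 hx,
    turn_congr (fun i => (hsgn i).1) fun i => (hsgn i).2,
    periCanonical_of_zigzag hn hm' hyN' hQ (fun k hka hkN => ?_) (fun k hka hkN => ?_), ?_⟩
  · rw [canonicalY_sub hka hkN, Int.abs_sign_of_ne_zero (sub_ne_zero.2 (hy k (by omega)))]
  · rw [canonicalX_of_ge hm hka, canonicalX_of_ge hm (by omega)]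
    push_cast
    rw [show (N : ℤ) - (k + 1) - (N - k) = -1 by ring, abs_neg, abs_one]
  · rw [perimeter_eq hn hm.closed hyN hP, perimeter_eq hn hm'.closed hyN' hQ, hm.sum_abs,
      hm'.sum_abs, sum_abs_canonicalY hm hs haN hyN hy, canonicalX_of_ge hm le_rfl,
      canonicalX_of_le (Nat.zero_le a)]
    push_cast
    omega
end
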